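/- arXiv:1303.3241 — 7 statements merged into one kernel-verified Lean document; each statement's English description precedes it below -/
import Mathlib

section
/- For all real numbers τ < 0, κ > 0 and p ∈ ℝ with |p| ≠ κ, one has the identity A(τ, κ, p) = (κ² / (κ² − p²)) · ( e^{−i p τ} + R(τ, κ, p) ). -/
open MeasureTheory Filter Real Complex

/-- The auxiliary function `A(τ, κ, p) = ∫_{-∞}^τ (κ τ²/t²) sin(κ(τ-t)) e^{-ipt} dt`. -/
noncomputable def auxA (τ κ p : ℝ) : ℂ :=
  ∫ t in Set.Iic τ,
    ((κ * τ ^ 2 / t ^ 2 * Real.sin (κ * (τ - t)) : ℝ) : ℂ) *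
      Complex.exp (-(Complex.I * (p : ℂ) * (t : ℂ)))

/-- The remainder `R(τ, κ, p) = τ² ∫_{-∞}^τ (4/t³ cos(κ(τ-t)) + 6/(κt⁴) sin(κ(τ-t))) e^{-ipt} dt`. -/
noncomputable def auxR (τ κ p : ℝ) : ℂ :=
  ((τ ^ 2 : ℝ) : ℂ) *
    ∫ t in Set.Iic τ,
      ((4 / t ^ 3 * Real.cos (κ * (τ - t)) + 6 / (κ * t ^ 4) * Real.sin (κ * (τ - t)) : ℝ) : ℂ) *
        Complex.exp (-(Complex.I * (p : ℂ) * (t : ℂ)))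

/-- A function on `(-∞, τ]` that is continuous and bounded by `C / t²` is integrable. -/
lemma integrableOn_aux (τ C : ℝ) (hτ : τ < 0) (f : ℝ → ℂ) (hc : ContinuousOn f (Set.Iic τ))
    (hb : ∀ t ≤ τ, ‖f t‖ ≤ C / t ^ 2) : IntegrableOn f (Set.Iic τ) := by
  have hi : IntegrableOn (fun t : ℝ => (C * (1 + 1 / τ ^ 2)) * (1 + t ^ 2)⁻¹) (Set.Iic τ) :=
    (integrable_inv_one_add_sq.const_mul _).integrableOn
  refine Integrable.mono' hi (hc.aestronglyMeasurable measurableSet_Iic) ?_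
  refine (ae_restrict_iff' measurableSet_Iic).2 (Eventually.of_forall fun t ht => ?_)
  have ht' : t ≤ τ := ht
  have ht0 : 0 < t ^ 2 := by nlinarith
  have hτ0 : 0 < τ ^ 2 := by nlinarith
  have h1 := hb t ht'
  have hC : 0 ≤ C := by
    have h2 : 0 ≤ C / t ^ 2 := (norm_nonneg _).trans h1
    by_contra hneg
    exact absurd (div_neg_of_neg_of_pos (not_le.1 hneg) ht0) (not_lt.2 h2)
  refine h1.trans ?_
  have h3 : 1 / t ^ 2 ≤ (1 + 1 / τ ^ 2) * (1 + t ^ 2)⁻¹ := by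
    rw [← div_eq_mul_inv, div_le_div_iff₀ ht0 (by positivity)]
    have h4 : 1 ≤ t ^ 2 / τ ^ 2 := by
      rw [le_div_iff₀ hτ0]; nlinarith
    have h5 : (1 + 1 / τ ^ 2) * t ^ 2 = t ^ 2 + t ^ 2 / τ ^ 2 := by ring
    linarith
  calc C / t ^ 2 = C * (1 / t ^ 2) := by ring
    _ ≤ C * ((1 + 1 / τ ^ 2) * (1 + t ^ 2)⁻¹) := mul_le_mul_of_nonneg_left h3 hC
    _ = _ := by ring

lemma norm_exp_aux (p t : ℝ) : ‖Complex.exp (-(Complex.I * (p : ℂ) * (t : ℂ)))‖ = 1 := by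
  have : -(Complex.I * (p : ℂ) * (t : ℂ)) = ((-(p * t) : ℝ) : ℂ) * Complex.I := by
    push_cast; ring
  rw [this, Complex.norm_exp_ofReal_mul_I]

/-- Bounds of the powers of `1 / t` by `1 / t²`. -/
lemma pow_aux (τ t : ℝ) (hτ : τ < 0) (ht : t ≤ τ) (n : ℕ) :
    |1 / t ^ (n + 2)| ≤ (1 / |τ|) ^ n * (1 / t ^ 2) := by
  have h0 : 0 < |τ| := abs_pos.2 hτ.ne
  have h1 : |τ| ≤ |t| := by rw [abs_of_neg hτ, abs_of_neg (by linarith)]; linarith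
  have h2 : 0 < |t| := by linarith
  have h3 : |1 / t ^ (n + 2)| = (1 / |t|) ^ n * (1 / t ^ 2) := by
    rw [abs_div, abs_one, abs_pow, ← sq_abs t, one_div_pow, pow_add]
    field_simp
  rw [h3]
  gcongr

lemma hasDerivAt_exp_aux (p t : ℝ) :
    HasDerivAt (fun t : ℝ => Complex.exp (-(Complex.I * (p : ℂ) * (t : ℂ))))
      (Complex.exp (-(Complex.I * (p : ℂ) * (t : ℂ))) * (-(Complex.I * p))) t := by
  have h : HasDerivAt (fun t : ℝ => -(Complex.I * (p : ℂ) * (t : ℂ))) (-(Complex.I * p)) t := by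
    simpa using ((Complex.ofRealCLM.hasDerivAt (x := t)).const_mul (Complex.I * (p : ℂ))).fun_neg
  exact h.cexp

/-- The function `h(t) = sin(κ(τ-t)) / t²`. -/
noncomputable def hFun (τ κ t : ℝ) : ℝ := 1 / t ^ 2 * Real.sin (κ * (τ - t))

/-- The derivative of `hFun`. -/
noncomputable def hFun1 (τ κ t : ℝ) : ℝ :=
  -2 * (1 / t ^ 3) * Real.sin (κ * (τ - t)) - κ * (1 / t ^ 2) * Real.cos (κ * (τ - t))

/-- The second derivative of `hFun`. -/
noncomputable def hFun2 (τ κ t : ℝ) : ℝ :=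
  4 * κ * (1 / t ^ 3) * Real.cos (κ * (τ - t)) + 6 * (1 / t ^ 4) * Real.sin (κ * (τ - t))
    - κ ^ 2 * (1 / t ^ 2) * Real.sin (κ * (τ - t))

lemma hasDerivAt_inv_pow_aux (t : ℝ) (ht : t ≠ 0) (n : ℕ) :
    HasDerivAt (fun t : ℝ => 1 / t ^ (n + 1)) (-(n + 1) * (1 / t ^ (n + 2))) t := by
  have h := (hasDerivAt_pow (n + 1) t).fun_inv (pow_ne_zero _ ht)
  simp only [one_div]
  refine h.congr_deriv ?_
  push_cast
  field_simp
  try ring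

lemma hasDerivAt_lin_aux (τ κ t : ℝ) : HasDerivAt (fun t : ℝ => κ * (τ - t)) (-κ) t := by
  simpa using ((hasDerivAt_id t).const_sub τ).const_mul κ

lemma hasDerivAt_hFun (τ κ t : ℝ) (ht : t ≠ 0) :
    HasDerivAt (hFun τ κ) (hFun1 τ κ t) t := by
  have h := (hasDerivAt_inv_pow_aux t ht 1).fun_mul (hasDerivAt_lin_aux τ κ t).sin
  refine h.congr_deriv ?_
  simp only [hFun1]
  push_cast
  ring

lemma hasDerivAt_hFun1 (τ κ t : ℝ) (ht : t ≠ 0) :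
    HasDerivAt (hFun1 τ κ) (hFun2 τ κ t) t := by
  have h := (((hasDerivAt_inv_pow_aux t ht 2).const_mul (-2)).fun_mul
    (hasDerivAt_lin_aux τ κ t).sin).fun_sub
    (((hasDerivAt_inv_pow_aux t ht 1).const_mul κ).fun_mul (hasDerivAt_lin_aux τ κ t).cos)
  refine h.congr_deriv ?_
  simp only [hFun2]
  push_cast
  ring

lemma abs_mul_le_aux (a b x C : ℝ) (h : |x| ≤ 1) (hb : |b| ≤ C) : |a * b * x| ≤ |a| * C := by
  rw [abs_mul, abs_mul]
  have hC : 0 ≤ C := (abs_nonneg _).trans hb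
  calc |a| * |b| * |x| ≤ |a| * C * 1 := by gcongr
    _ = _ := by ring

lemma tendsto_zero_aux (τ C : ℝ) (hτ : τ < 0) (f : ℝ → ℂ)
    (hb : ∀ t ≤ τ, ‖f t‖ ≤ C / t ^ 2) : Tendsto f atBot (nhds 0) := by
  have h1 : Tendsto (fun t : ℝ => t ^ 2) atBot atTop := by
    have := (tendsto_pow_atTop (α := ℝ) (n := 2) (by norm_num)).comp tendsto_neg_atBot_atTop
    refine this.congr fun t => ?_
    simp
  refine squeeze_zero_norm' ?_ (h1.const_div_atTop C)
  filter_upwards [eventually_le_atBot τ] with t ht using hb t ht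

/-- For `τ < 0`, `κ > 0` and `|p| ≠ κ`, the identity
`A(τ, κ, p) = κ²/(κ² - p²) (e^{-ipτ} + R(τ, κ, p))` holds. -/
theorem auxA_eq_R (τ κ p : ℝ) (hτ : τ < 0) (hκ : 0 < κ) (hp : |p| ≠ κ) :
    auxA τ κ p =
      ((κ ^ 2 / (κ ^ 2 - p ^ 2) : ℝ) : ℂ) *
        (Complex.exp (-(Complex.I * (p : ℂ) * (τ : ℂ))) + auxR τ κ p) := by
  have hne : (κ ^ 2 - p ^ 2 : ℝ) ≠ 0 := by
    intro h
    apply hp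
    have h2 : |p| ^ 2 = κ ^ 2 := by rw [sq_abs]; linarith
    exact (pow_left_inj₀ (abs_nonneg p) hκ.le two_ne_zero).1 h2
  set E : ℝ → ℂ := fun t => Complex.exp (-(Complex.I * (p : ℂ) * (t : ℂ))) with hE
  have hEc : Continuous E := by fun_prop
  have hEn : ∀ t, ‖E t‖ = 1 := norm_exp_aux p
  have hn0 : ∀ t ∈ Set.Iic τ, t ≠ 0 := fun t ht => by
    have : t ≤ τ := ht
    exact (by linarith : t < 0).ne
  set u : ℝ → ℂ := fun t => (hFun τ κ t : ℂ) * E t with hu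
  set v : ℝ → ℂ := fun t =>
    ((4 * κ * (1 / t ^ 3) * Real.cos (κ * (τ - t)) + 6 * (1 / t ^ 4) * Real.sin (κ * (τ - t)) : ℝ) : ℂ)
      * E t with hv
  have hA : auxA τ κ p = ((κ * τ ^ 2 : ℝ) : ℂ) * ∫ t in Set.Iic τ, u t := by
    rw [auxA, ← integral_const_mul]
    congr 1
    funext t
    simp only [hu, hE, hFun]
    push_cast
    ring
  have hκ' : (κ : ℂ) ≠ 0 := by exact_mod_cast hκ.ne'
  have hR : auxR τ κ p = ((τ ^ 2 / κ : ℝ) : ℂ) * ∫ t in Set.Iic τ, v t := by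
    rw [auxR, ← integral_const_mul, ← integral_const_mul]
    congr 1
    funext t
    simp only [hv, hE]
    push_cast
    field_simp
  have hP2 : ∀ t ≤ τ, |1 / t ^ 2| ≤ 1 / t ^ 2 := fun t ht => by
    simpa using pow_aux τ t hτ ht 0
  have hP3 : ∀ t ≤ τ, |1 / t ^ 3| ≤ 1 / |τ| * (1 / t ^ 2) := fun t ht => by
    simpa using pow_aux τ t hτ ht 1
  have hP4 : ∀ t ≤ τ, |1 / t ^ 4| ≤ (1 / |τ|) ^ 2 * (1 / t ^ 2) := fun t ht =>
    pow_aux τ t hτ ht 2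
  have hub : ∀ t ≤ τ, ‖u t‖ ≤ 1 / t ^ 2 := fun t ht => by
    simp only [hu, norm_mul, hEn, mul_one, Complex.norm_real, Real.norm_eq_abs, hFun]
    have := abs_mul_le_aux 1 _ _ _ (Real.abs_sin_le_one (κ * (τ - t))) (hP2 t ht)
    simpa only [one_mul, abs_one, abs_mul] using this
  have hvb : ∀ t ≤ τ, ‖v t‖ ≤ (|4 * κ| * (1 / |τ|) + |6| * (1 / |τ|) ^ 2) / t ^ 2 := fun t ht => by
    simp only [hv, norm_mul, hEn, mul_one, Complex.norm_real, Real.norm_eq_abs]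
    have h1 := abs_mul_le_aux (4 * κ) _ _ _ (Real.abs_cos_le_one (κ * (τ - t))) (hP3 t ht)
    have h2 := abs_mul_le_aux 6 _ _ _ (Real.abs_sin_le_one (κ * (τ - t))) (hP4 t ht)
    refine (abs_add_le _ _).trans ((add_le_add h1 h2).trans (le_of_eq ?_))
    ring
  have hwb : ∀ t ≤ τ, ‖(hFun1 τ κ t : ℂ) * E t‖ ≤ (|(-2)| * (1 / |τ|) + |κ|) / t ^ 2 := fun t ht => by
    simp only [norm_mul, hEn, mul_one, Complex.norm_real, Real.norm_eq_abs, hFun1]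
    have h1 := abs_mul_le_aux (-2) _ _ _ (Real.abs_sin_le_one (κ * (τ - t))) (hP3 t ht)
    have h2 := abs_mul_le_aux κ _ _ _ (Real.abs_cos_le_one (κ * (τ - t))) (hP2 t ht)
    refine (abs_sub _ _).trans ((add_le_add h1 h2).trans (le_of_eq ?_))
    ring
  have hui : IntegrableOn u (Set.Iic τ) := by
    refine integrableOn_aux τ 1 hτ u ?_ hub
    refine ContinuousOn.mul (Complex.continuous_ofReal.comp_continuousOn ?_) hEc.continuousOn
    exact fun t ht => (hasDerivAt_hFun τ κ t (hn0 t ht)).continuousAt.continuousWithinAt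
  have hvi : IntegrableOn v (Set.Iic τ) := by
    refine integrableOn_aux τ _ hτ v ?_ hvb
    refine ContinuousOn.mul (Complex.continuous_ofReal.comp_continuousOn ?_) hEc.continuousOn
    have hq : ∀ n : ℕ, ContinuousOn (fun t : ℝ => 1 / t ^ n) (Set.Iic τ) := fun n =>
      continuousOn_const.div (continuous_pow n).continuousOn fun t ht => pow_ne_zero _ (hn0 t ht)
    have hs : Continuous fun t : ℝ => Real.sin (κ * (τ - t)) := by fun_prop
    have hc : Continuous fun t : ℝ => Real.cos (κ * (τ - t)) := by fun_prop
    exact ((continuousOn_const.mul (hq 3)).mul hc.continuousOn).add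
      ((continuousOn_const.mul (hq 4)).mul hs.continuousOn)
  set F : ℝ → ℂ := fun t =>
    (-(Complex.I * p)) * ((hFun τ κ t : ℂ) * E t) - (hFun1 τ κ t : ℂ) * E t with hF
  have hFd : ∀ t ∈ Set.Iic τ, HasDerivAt F (((κ ^ 2 - p ^ 2 : ℝ) : ℂ) * u t - v t) t := by
    intro t ht
    have h0 := hn0 t ht
    have e := hasDerivAt_exp_aux p t
    have d := (((hasDerivAt_hFun τ κ t h0).ofReal_comp.fun_mul e).const_mul
      (-(Complex.I * (p : ℂ)))).fun_sub ((hasDerivAt_hFun1 τ κ t h0).ofReal_comp.fun_mul e)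
    refine d.congr_deriv ?_
    simp only [hu, hv, hE, hFun, hFun1, hFun2]
    push_cast
    ring_nf
    simp only [Complex.I_sq]
    ring
  have hFt : Tendsto F atBot (nhds 0) := by
    have h1 := tendsto_zero_aux τ _ hτ _ hub
    have h2 := tendsto_zero_aux τ _ hτ _ hwb
    have h3 := (h1.const_mul (-(Complex.I * (p : ℂ)))).sub h2
    rw [mul_zero, sub_zero] at h3
    exact h3
  have key := integral_Iic_of_hasDerivAt_of_tendsto' hFd ((hui.const_mul _).sub hvi) hFt
  rw [integral_sub (hui.const_mul _) hvi, integral_const_mul] at key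
  have hFτ : F τ = (κ / τ ^ 2 : ℝ) * E τ := by
    simp only [hF, hFun, hFun1, sub_self, mul_zero, Real.sin_zero, Real.cos_zero]
    push_cast
    ring
  rw [hFτ, sub_zero] at key
  rw [hA, hR]
  have hne' : ((κ : ℂ) ^ 2 - (p : ℂ) ^ 2) ≠ 0 := by exact_mod_cast hne
  have hτ' : (τ : ℂ) ≠ 0 := by exact_mod_cast hτ.ne
  have hEτ : Complex.exp (-(Complex.I * (p : ℂ) * (τ : ℂ))) = E τ := rfl
  rw [hEτ]
  generalize (∫ t in Set.Iic τ, u t) = U at *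
  generalize (∫ t in Set.Iic τ, v t) = V at *
  push_cast at key ⊢
  have hV : V = ((κ : ℂ) ^ 2 - (p : ℂ) ^ 2) * U - κ / τ ^ 2 * E τ := by rw [← key]; ring
  rw [hV]
  field_simp
  ring
end

section
/- For all real numbers κ > 0 and p ∈ ℝ with |p| ≠ κ, the remainder tends to zero at early times: R(τ, κ, p) → 0 as τ → −∞. -/
open MeasureTheory Filter Real Complex

lemma aux_int_pow (T : ℝ) (hT : 0 < T) (n : ℕ) (hn : 2 ≤ n) :
    IntegrableOn (fun x : ℝ => 1 / x ^ n) (Set.Ioi T) := by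
  have hn' : (2 : ℝ) ≤ n := by exact_mod_cast hn
  have h := integrableOn_Ioi_rpow_of_lt (a := -(n : ℝ)) (by linarith) hT
  refine h.congr_fun (fun x hx => ?_) measurableSet_Ioi
  have hx0 : 0 < x := hT.trans hx
  simp [Real.rpow_neg hx0.le]

lemma aux_int_four (T : ℝ) (hT : 0 < T) :
    ∫ x in Set.Ioi T, 1 / x ^ 4 = 1 / (3 * T ^ 3) := by
  have h := integral_Ioi_rpow_of_lt (a := -((4 : ℕ) : ℝ)) (by norm_num) hT
  have h2 : ∫ x in Set.Ioi T, 1 / x ^ 4 = ∫ x in Set.Ioi T, x ^ (-((4 : ℕ) : ℝ)) := by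
    refine setIntegral_congr_fun measurableSet_Ioi (fun x hx => ?_)
    have hx0 : 0 < x := hT.trans hx
    simp only [Real.rpow_neg hx0.le, Real.rpow_natCast, one_div]
  rw [h2, h]
  have : (-((4 : ℕ) : ℝ) + 1) = -((3 : ℕ) : ℝ) := by norm_num
  rw [this, Real.rpow_neg hT.le, Real.rpow_natCast]
  push_cast
  field_simp

/-- oscillating primitive -/
noncomputable def auxF (T κ p x : ℝ) : ℂ :=
  (Complex.I * p * (Real.cos (κ * (x - T)) : ℂ) + κ * (Real.sin (κ * (x - T)) : ℂ)) /
    ((κ ^ 2 - p ^ 2 : ℝ) : ℂ) * Complex.exp (Complex.I * p * x)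

lemma aux_norm_exp (p x : ℝ) : ‖Complex.exp (Complex.I * p * x)‖ = 1 := by
  have : Complex.I * p * x = ((p * x : ℝ) : ℂ) * Complex.I := by push_cast; ring
  rw [this, Complex.norm_exp_ofReal_mul_I]

lemma auxF_deriv (T κ p x : ℝ) (h : κ ^ 2 - p ^ 2 ≠ 0) :
    HasDerivAt (auxF T κ p) ((Real.cos (κ * (x - T)) : ℂ) * Complex.exp (Complex.I * p * x)) x := by
  have hl : HasDerivAt (fun x : ℝ => κ * (x - T)) κ x := by
    simpa using ((hasDerivAt_id x).sub_const T).const_mul κ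
  have hc := (hl.cos).ofReal_comp
  have hs := (hl.sin).ofReal_comp
  have he : HasDerivAt (fun x : ℝ => Complex.exp (Complex.I * p * x))
      (Complex.exp (Complex.I * p * x) * (Complex.I * p)) x := by
    have := ((hasDerivAt_id x).ofReal_comp.const_mul (Complex.I * p)).cexp
    simpa using this
  have h' : ((κ ^ 2 - p ^ 2 : ℝ) : ℂ) ≠ 0 := by exact_mod_cast h
  have := ((((hc.const_mul (Complex.I * p)).add (hs.const_mul (κ : ℂ))).div_const
    ((κ ^ 2 - p ^ 2 : ℝ) : ℂ))).mul he
  refine this.congr_deriv ?_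
  simp only [Pi.add_apply]
  field_simp
  push_cast
  linear_combination (p : ℂ) ^ 2 * Complex.cos (κ * (x - T)) * Complex.I_sq

lemma auxF_norm (T κ p x : ℝ) : ‖auxF T κ p x‖ ≤ (|p| + |κ|) / |κ ^ 2 - p ^ 2| := by
  unfold auxF
  rw [norm_mul, aux_norm_exp, mul_one, norm_div, Complex.norm_real, Real.norm_eq_abs]
  gcongr
  refine (norm_add_le _ _).trans ?_
  simp only [norm_mul, Complex.norm_I, Complex.norm_real, Real.norm_eq_abs, one_mul]
  gcongr
  · exact mul_le_of_le_one_right (abs_nonneg _) (Real.abs_cos_le_one _)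
  · exact mul_le_of_le_one_right (abs_nonneg _) (Real.abs_sin_le_one _)

lemma auxF_cont (T κ p : ℝ) : Continuous (auxF T κ p) := by
  unfold auxF
  fun_prop

/-- generic integrability -/
lemma aux_integrable (T : ℝ) (hT : 0 < T) (n : ℕ) (hn : 2 ≤ n) (f : ℝ → ℂ) (hf : Continuous f)
    (C : ℝ) (hC : ∀ x, ‖f x‖ ≤ C) :
    IntegrableOn (fun x : ℝ => ((1 / x ^ n : ℝ) : ℂ) * f x) (Set.Ioi T) := by
  have h1 := (aux_int_pow T hT n hn).ofReal (𝕜 := ℂ)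
  exact h1.mul_bdd hf.aestronglyMeasurable (ae_of_all _ hC)

lemma aux_bound (T κ p : ℝ) (hT : 0 < T) (hκ : 0 < κ) (h : κ ^ 2 - p ^ 2 ≠ 0) (C : ℝ)
    (hC : C = (|p| + |κ|) / |κ ^ 2 - p ^ 2|) :
    ‖∫ x in Set.Ioi T, (((1 / x ^ 3 : ℝ) : ℂ) *
        (-4 * ((Real.cos (κ * (x - T)) : ℂ) * Complex.exp (Complex.I * p * x))) +
      ((1 / x ^ 4 : ℝ) : ℂ) *
        (6 / κ * ((Real.sin (κ * (x - T)) : ℂ) * Complex.exp (Complex.I * p * x))))‖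
      ≤ (4 * C + (12 * C + 6 / κ) / 3) / T ^ 3 := by
  have hF : ∀ x, ‖auxF T κ p x‖ ≤ C := fun x => hC ▸ auxF_norm T κ p x
  set c : ℝ → ℂ := fun x => (Real.cos (κ * (x - T)) : ℂ) * Complex.exp (Complex.I * p * x) with hc
  set s : ℝ → ℂ := fun x => (Real.sin (κ * (x - T)) : ℂ) * Complex.exp (Complex.I * p * x) with hs
  have hcc : Continuous c := by rw [hc]; fun_prop
  have hsc : Continuous s := by rw [hs]; fun_prop
  have hcb : ∀ x, ‖c x‖ ≤ 1 := fun x => by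
    simp only [hc, norm_mul, aux_norm_exp, mul_one, Complex.norm_real, Real.norm_eq_abs]
    exact Real.abs_cos_le_one _
  have hsb : ∀ x, ‖s x‖ ≤ 1 := fun x => by
    simp only [hs, norm_mul, aux_norm_exp, mul_one, Complex.norm_real, Real.norm_eq_abs]
    exact Real.abs_sin_le_one _
  have hκn : ‖(6 / κ : ℂ)‖ = 6 / κ := by
    rw [norm_div, Complex.norm_real, Real.norm_eq_abs, abs_of_pos hκ]; norm_num
  -- the derivative part
  set D : ℝ → ℂ := fun x => ((1 / x ^ 3 : ℝ) : ℂ) * (-4 * c x)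
    + ((1 / x ^ 4 : ℝ) : ℂ) * (12 * auxF T κ p x) with hD
  set H : ℝ → ℂ := fun x => ((1 / x ^ 4 : ℝ) : ℂ) * (6 / κ * s x - 12 * auxF T κ p x) with hH
  have hHb : ∀ x, ‖6 / κ * s x - 12 * auxF T κ p x‖ ≤ 12 * C + 6 / κ := fun x => by
    refine (norm_sub_le _ _).trans ?_
    rw [norm_mul _ (s x), norm_mul _ (auxF T κ p x), hκn]
    have h1 : 6 / κ * ‖s x‖ ≤ 6 / κ := mul_le_of_le_one_right (by positivity) (hsb x)
    have h2 : ‖(12 : ℂ)‖ = 12 := by norm_num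
    rw [h2]
    linarith [hF x]
  have iD : IntegrableOn D (Set.Ioi T) := by
    refine (aux_integrable T hT 3 (by norm_num) (fun x => -4 * c x) (by fun_prop) 4 ?_).add
      (aux_integrable T hT 4 (by norm_num) (fun x => 12 * auxF T κ p x)
        ((auxF_cont T κ p).const_mul _) (12 * C) ?_)
    · intro x; simp only [norm_mul, norm_neg, Complex.norm_ofNat]; linarith [hcb x]
    · intro x; simp only [norm_mul, Complex.norm_ofNat]; linarith [hF x]
  have iH : IntegrableOn H (Set.Ioi T) :=
    aux_integrable T hT 4 (by norm_num) (fun x => 6 / κ * s x - 12 * auxF T κ p x)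
      ((hsc.const_mul _).sub ((auxF_cont T κ p).const_mul _)) _ hHb
  have hsplit : (∫ x in Set.Ioi T, (((1 / x ^ 3 : ℝ) : ℂ) * (-4 * c x) +
      ((1 / x ^ 4 : ℝ) : ℂ) * (6 / κ * s x))) = (∫ x in Set.Ioi T, D x) + ∫ x in Set.Ioi T, H x := by
    rw [← integral_add iD iH]
    congr 1
    ext x
    simp only [hD, hH]
    ring
  have hGb : ∀ x > 0, ‖((1 / x ^ 3 : ℝ) : ℂ) * (-4 * auxF T κ p x)‖ ≤ 4 * C * (1 / x ^ 3) := by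
    intro x hx
    rw [norm_mul, norm_mul, norm_neg, Complex.norm_ofNat, Complex.norm_real, Real.norm_eq_abs,
      abs_of_pos (by positivity), mul_comm]
    gcongr
    exact hF x
  have hDint : ∫ x in Set.Ioi T, D x = 0 - ((1 / T ^ 3 : ℝ) : ℂ) * (-4 * auxF T κ p T) := by
    refine integral_Ioi_of_hasDerivAt_of_tendsto'
      (f := fun x => ((1 / x ^ 3 : ℝ) : ℂ) * (-4 * auxF T κ p x)) ?_ iD ?_
    · intro x hx
      have hx0 : 0 < x := hT.trans_le hx
      have h1 : HasDerivAt (fun x : ℝ => 1 / x ^ 3) (-3 / x ^ 4) x := by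
        have := (hasDerivAt_pow 3 x).inv (by positivity)
        simp only [one_div]
        refine this.congr_deriv ?_
        field_simp
        norm_num
        ring
      have := h1.ofReal_comp.mul ((auxF_deriv T κ p x h).const_mul (-4 : ℂ))
      refine this.congr_deriv ?_
      simp only [hD, hc]
      push_cast
      ring
    · rw [tendsto_zero_iff_norm_tendsto_zero]
      have hlim : Tendsto (fun x : ℝ => 4 * C * (1 / x ^ 3)) atTop (nhds 0) := by
        have := (tendsto_pow_neg_atTop (𝕜 := ℝ) (n := 3) (by norm_num)).const_mul (4 * C)
        simpa [zpow_neg] using this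
      refine squeeze_zero' (Eventually.of_forall fun x => norm_nonneg _) ?_ hlim
      filter_upwards [eventually_gt_atTop 0] with x hx using hGb x hx
  have hHint : ‖∫ x in Set.Ioi T, H x‖ ≤ (12 * C + 6 / κ) * (1 / (3 * T ^ 3)) := by
    rw [← aux_int_four T hT, ← integral_const_mul]
    refine norm_integral_le_of_norm_le ((aux_int_pow T hT 4 (by norm_num)).const_mul _) ?_
    refine (ae_restrict_iff' measurableSet_Ioi).2 (ae_of_all _ fun x hx => ?_)
    have hx0 : 0 < x := hT.trans hx
    simp only [hH]
    rw [norm_mul, Complex.norm_real, Real.norm_eq_abs, abs_of_pos (by positivity), mul_comm]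
    gcongr
    exact hHb x
  change ‖∫ x in Set.Ioi T, (((1 / x ^ 3 : ℝ) : ℂ) * (-4 * c x) +
      ((1 / x ^ 4 : ℝ) : ℂ) * (6 / κ * s x))‖ ≤ _
  rw [hsplit, hDint, zero_sub]
  refine (norm_add_le _ _).trans ?_
  rw [norm_neg]
  refine (add_le_add (hGb T hT) hHint).trans (le_of_eq ?_)
  field_simp

/-- For all `κ > 0` and `p` with `|p| ≠ κ`, the remainder `R(τ, κ, p)` tends to zero
as `τ → -∞`. -/
theorem auxR_tendsto_zero (κ p : ℝ) (hκ : 0 < κ) (hp : |p| ≠ κ) :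
    Filter.Tendsto (fun τ : ℝ => auxR τ κ p) Filter.atBot (nhds 0) := by
  have h : κ ^ 2 - p ^ 2 ≠ 0 := by
    intro h
    apply hp
    have : p ^ 2 = κ ^ 2 := by linarith
    rw [sq_eq_sq_iff_abs_eq_abs, abs_of_pos hκ] at this
    exact this
  obtain ⟨C, hC⟩ : ∃ C, C = (|p| + |κ|) / |κ ^ 2 - p ^ 2| := ⟨_, rfl⟩
  obtain ⟨M, hM⟩ : ∃ M, M = 4 * C + (12 * C + 6 / κ) / 3 := ⟨_, rfl⟩
  rw [tendsto_zero_iff_norm_tendsto_zero]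
  have hlim : Tendsto (fun τ : ℝ => M * (-τ)⁻¹) atBot (nhds 0) := by
    have := (tendsto_inv_atTop_zero.comp tendsto_neg_atBot_atTop : Tendsto _ (atBot : Filter ℝ) _)
    simpa using this.const_mul M
  refine squeeze_zero' (Eventually.of_forall fun x => norm_nonneg _) ?_ hlim
  filter_upwards [eventually_lt_atBot 0] with τ hτ
  have hT : 0 < -τ := by linarith
  have hb := aux_bound (-τ) κ p hT hκ h C hC
  rw [← hM, ← integral_comp_neg_Iic] at hb
  have heq : auxR τ κ p = ((τ ^ 2 : ℝ) : ℂ) * ∫ x in Set.Iic τ, (((1 / (-x) ^ 3 : ℝ) : ℂ) *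
        (-4 * ((Real.cos (κ * (-x - -τ)) : ℂ) * Complex.exp (Complex.I * p * (-x : ℝ)))) +
      ((1 / (-x) ^ 4 : ℝ) : ℂ) *
        (6 / κ * ((Real.sin (κ * (-x - -τ)) : ℂ) * Complex.exp (Complex.I * p * (-x : ℝ))))) := by
    unfold auxR
    congr 1
    refine setIntegral_congr_fun measurableSet_Iic (fun x hx => ?_)
    have hx0 : (x : ℂ) ≠ 0 := by
      have : x < 0 := lt_of_le_of_lt hx hτ
      exact_mod_cast this.ne
    have hκ0 : (κ : ℂ) ≠ 0 := by exact_mod_cast hκ.ne'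
    have e1 : κ * (-x - -τ) = κ * (τ - x) := by ring
    have e2 : Complex.I * p * ((-x : ℝ) : ℂ) = -(Complex.I * p * x) := by push_cast; ring
    have e3 : (-x) ^ 3 = - x ^ 3 := by ring
    have e4 : (-x) ^ 4 = x ^ 4 := by ring
    simp only [e1, e2, e3, e4]
    push_cast
    field_simp
  rw [heq, norm_mul, Complex.norm_real, Real.norm_eq_abs, abs_of_nonneg (sq_nonneg τ)]
  refine (mul_le_mul_of_nonneg_left hb (sq_nonneg τ)).trans (le_of_eq ?_)
  have : τ ≠ 0 := hτ.ne
  field_simp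
end

section
/- For all real numbers τ < 0, κ > 0 and p ≠ 0, one has the identity A(τ, κ, p) = (i κ² τ² / p) · ∫_{−∞}^τ ( (1 / t²) · cos(κ(τ − t)) + (2 / (κ t³)) · sin(κ(τ − t)) ) · e^{−i p t} dt. -/
open MeasureTheory Filter Real Complex

lemma inv_sq_integrableOn (τ : ℝ) (hτ : τ < 0) :
    IntegrableOn (fun t : ℝ => 1 / t ^ 2) (Set.Iic τ) := by
  have h := integrableOn_Ioi_rpow_of_lt (a := -2) (by norm_num) (neg_pos.mpr hτ)
  have h2 : IntegrableOn (fun t : ℝ => 1 / t ^ 2) (Set.Ioi (-τ)) := by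
    refine h.congr_fun (fun x hx => ?_) measurableSet_Ioi
    have hx0 : 0 < x := (neg_pos.mpr hτ).trans hx
    simp only
    rw [Real.rpow_neg hx0.le]
    norm_num
  rw [← integrableOn_Ici_iff_integrableOn_Ioi] at h2
  have h3 := h2.comp_neg
  simpa using h3

lemma integrableOn_of_bound (τ p C : ℝ) (hτ : τ < 0) (u : ℝ → ℝ)
    (hu : ContinuousOn u (Set.Iic τ)) (hb : ∀ t ∈ Set.Iic τ, |u t| ≤ C * (1 / t ^ 2)) :
    IntegrableOn (fun t : ℝ => (u t : ℂ) *
      Complex.exp (-(Complex.I * (p : ℂ) * (t : ℂ)))) (Set.Iic τ) := by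
  refine Integrable.mono' ((inv_sq_integrableOn τ hτ).const_mul C) ?_ ?_
  · refine ContinuousOn.aestronglyMeasurable ?_ measurableSet_Iic
    refine ContinuousOn.mul (Complex.continuous_ofReal.comp_continuousOn hu) ?_
    fun_prop
  · refine (ae_restrict_iff' measurableSet_Iic).mpr (ae_of_all _ fun t ht => ?_)
    have he : ‖Complex.exp (-(Complex.I * (p : ℂ) * (t : ℂ)))‖ = 1 := by
      rw [Complex.norm_exp]; simp
    rw [norm_mul, he, mul_one, Complex.norm_real]
    exact hb t ht

/-- For all `τ < 0`, `κ > 0` and `p ≠ 0`, one has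
`A(τ, κ, p) = (i κ² τ²/p) ∫_{-∞}^τ (1/t² cos(κ(τ-t)) + 2/(κt³) sin(κ(τ-t))) e^{-ipt} dt`. -/
theorem auxA_integration_by_parts (τ κ p : ℝ) (hτ : τ < 0) (hκ : 0 < κ) (hp : p ≠ 0) :
    auxA τ κ p =
      Complex.I * (κ : ℂ) ^ 2 * (τ : ℂ) ^ 2 / (p : ℂ) *
        ∫ t in Set.Iic τ,
          ((1 / t ^ 2 * Real.cos (κ * (τ - t)) + 2 / (κ * t ^ 3) * Real.sin (κ * (τ - t)) : ℝ) : ℂ) *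
            Complex.exp (-(Complex.I * (p : ℂ) * (t : ℂ))) := by
  have ht0 : ∀ t ∈ Set.Iic τ, t ≠ 0 := fun t ht => (lt_of_le_of_lt ht hτ).ne
  have hF := integrableOn_of_bound τ p (κ * τ ^ 2) hτ
    (fun t => κ * τ ^ 2 / t ^ 2 * Real.sin (κ * (τ - t)))
    (by
      refine ContinuousOn.mul (ContinuousOn.div (by fun_prop) (by fun_prop) ?_) (by fun_prop)
      intro t ht; exact pow_ne_zero _ (ht0 t ht))
    (by
      intro t ht
      rw [abs_mul, abs_of_nonneg (by positivity : 0 ≤ κ * τ ^ 2 / t ^ 2), mul_one_div]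
      exact mul_le_of_le_one_right (by positivity) (Real.abs_sin_le_one _))
  have hG := integrableOn_of_bound τ p (1 + 2 / (κ * |τ|)) hτ
    (fun t => 1 / t ^ 2 * Real.cos (κ * (τ - t)) + 2 / (κ * t ^ 3) * Real.sin (κ * (τ - t)))
    (by
      refine ContinuousOn.add
        (ContinuousOn.mul (ContinuousOn.div (by fun_prop) (by fun_prop) ?_) (by fun_prop))
        (ContinuousOn.mul (ContinuousOn.div (by fun_prop) (by fun_prop) ?_) (by fun_prop))
      · intro t ht; exact pow_ne_zero _ (ht0 t ht)
      · intro t ht; exact mul_ne_zero hκ.ne' (pow_ne_zero _ (ht0 t ht)))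
    (by
      intro t ht
      have hτ' : 0 < |τ| := abs_pos.mpr hτ.ne
      have htn : t < 0 := lt_of_le_of_lt ht hτ
      have hle : |τ| ≤ |t| := by
        rw [abs_of_neg hτ, abs_of_neg htn]; exact neg_le_neg ht
      have h1 : |1 / t ^ 2 * Real.cos (κ * (τ - t))| ≤ 1 / t ^ 2 := by
        rw [abs_mul, abs_of_nonneg (by positivity : 0 ≤ 1 / t ^ 2)]
        exact mul_le_of_le_one_right (by positivity) (Real.abs_cos_le_one _)
      have h2 : |2 / (κ * t ^ 3) * Real.sin (κ * (τ - t))| ≤ 2 / (κ * |τ|) * (1 / t ^ 2) := by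
        rw [abs_mul]
        refine (mul_le_of_le_one_right (abs_nonneg _) (Real.abs_sin_le_one _)).trans ?_
        have : |2 / (κ * t ^ 3)| = 2 / (κ * |t|) * (1 / t ^ 2) := by
          rw [abs_div, abs_mul, abs_of_pos hκ, abs_pow, ← sq_abs t]
          have : |t| ≠ 0 := (abs_pos.mpr htn.ne).ne'
          field_simp
          norm_num
        rw [this]
        gcongr
      refine (abs_add_le _ _).trans ?_
      linarith)
  have hpc : (p : ℂ) ≠ 0 := by exact_mod_cast hp
  have hκc : (κ : ℂ) ≠ 0 := by exact_mod_cast hκ.ne'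
  set c : ℂ := Complex.I * (κ : ℂ) ^ 2 * (τ : ℂ) ^ 2 / (p : ℂ) with hc
  have hderiv : ∀ t ∈ Set.Iic τ, HasDerivAt (fun t : ℝ => Complex.I / p *
      (((κ * τ ^ 2 / t ^ 2 * Real.sin (κ * (τ - t)) : ℝ) : ℂ) *
        Complex.exp (-(Complex.I * (p : ℂ) * (t : ℂ)))))
      (((κ * τ ^ 2 / t ^ 2 * Real.sin (κ * (τ - t)) : ℝ) : ℂ) *
        Complex.exp (-(Complex.I * (p : ℂ) * (t : ℂ))) -
       c * (((1 / t ^ 2 * Real.cos (κ * (τ - t)) +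
          2 / (κ * t ^ 3) * Real.sin (κ * (τ - t)) : ℝ) : ℂ) *
            Complex.exp (-(Complex.I * (p : ℂ) * (t : ℂ))))) t := by
    intro t ht
    have h0 := ht0 t ht
    have h0c : (t : ℂ) ≠ 0 := by exact_mod_cast h0
    have hs : HasDerivAt (fun t : ℝ => Real.sin (κ * (τ - t)))
        (Real.cos (κ * (τ - t)) * (κ * (-1))) t :=
      (((hasDerivAt_id t).const_sub τ).const_mul κ).sin
    have hq : HasDerivAt (fun t : ℝ => κ * τ ^ 2 / t ^ 2)
        ((0 * t ^ 2 - κ * τ ^ 2 * (2 * t)) / (t ^ 2) ^ 2) t := by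
      have := (hasDerivAt_const t (κ * τ ^ 2)).div (hasDerivAt_pow 2 t) (pow_ne_zero _ h0)
      exact this.congr_deriv (by norm_num)
    have he : HasDerivAt (fun t : ℝ => Complex.exp (-(Complex.I * (p : ℂ) * (t : ℂ))))
        (Complex.exp (-(Complex.I * (p : ℂ) * (t : ℂ))) * (-(Complex.I * p * 1))) t :=
      ((((hasDerivAt_id t).ofReal_comp).const_mul (Complex.I * (p : ℂ))).neg).cexp
    have hall := (((hq.mul hs).ofReal_comp).mul he).const_mul (Complex.I / (p : ℂ))
    refine hall.congr_deriv ?_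
    simp only [Pi.mul_apply, hc]
    push_cast
    field_simp
    ring_nf
    simp only [Complex.I_sq]
    ring
  have hI := hF.sub (hG.const_mul c)
  have hlim := tendsto_zero_of_hasDerivAt_of_integrableOn_Iic hderiv hI (hF.const_mul _)
  have hfin := integral_Iic_of_hasDerivAt_of_tendsto' hderiv hI hlim
  rw [integral_sub hF (hG.const_mul c), integral_const_mul] at hfin
  simp only [sub_self, mul_zero, Real.sin_zero, Complex.ofReal_zero, zero_mul] at hfin
  exact sub_eq_zero.mp hfin
end

section
/- For all real numbers τ < 0 and p > κ > 0, the auxiliary function has the closed form A(τ, κ, p) = (i/2) · κ τ · ( e^{i κ τ} · ∫_1^∞ e^{−i (p + κ) τ t} / t² dt − e^{−i κ τ} · ∫_1^∞ e^{−i (p − κ) τ t} / t² dt ), where both integrals over [1, ∞) converge absolutely. -/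
open MeasureTheory Filter Real Complex

theorem auxA_integrable (c : ℝ) : MeasureTheory.IntegrableOn
    (fun t : ℝ => Complex.exp (-(Complex.I * ((c * t : ℝ) : ℂ))) / (t : ℂ) ^ 2)
    (Set.Ici 1) := by
  rw [integrableOn_Ici_iff_integrableOn_Ioi]
  have h : IntegrableOn (fun t : ℝ => t ^ (-2 : ℝ)) (Set.Ioi 1) :=
    integrableOn_Ioi_rpow_of_lt (by norm_num) one_pos
  refine Integrable.mono' h ?_ ?_
  · apply Measurable.aestronglyMeasurable
    fun_prop
  · refine (ae_restrict_iff' measurableSet_Ioi).2 (Eventually.of_forall fun t ht => ?_)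
    have ht0 : (0 : ℝ) < t := lt_trans one_pos ht
    have e : -(Complex.I * ((c * t : ℝ) : ℂ)) = ((-(c * t) : ℝ) : ℂ) * Complex.I := by
      push_cast; ring
    rw [norm_div, e, Complex.norm_exp_ofReal_mul_I, norm_pow, Complex.norm_real,
      Real.norm_of_nonneg ht0.le, Real.rpow_neg ht0.le]
    norm_num

/-- For `τ < 0` and `p > κ > 0`, the auxiliary function has the closed form
`A(τ, κ, p) = (i/2) κτ (e^{iκτ} ∫_1^∞ e^{-i(p+κ)τt}/t² dt - e^{-iκτ} ∫_1^∞ e^{-i(p-κ)τt}/t² dt)`,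
where both integrals over `[1, ∞)` (generalized exponential integrals `E₂`) converge
absolutely. -/
theorem auxA_closed_form (τ κ p : ℝ) (hτ : τ < 0) (hκ : 0 < κ) (hp : κ < p) :
    MeasureTheory.IntegrableOn
        (fun t : ℝ => Complex.exp (-(Complex.I * (((p + κ) * τ * t : ℝ) : ℂ))) / (t : ℂ) ^ 2)
        (Set.Ici 1) ∧
    MeasureTheory.IntegrableOn
        (fun t : ℝ => Complex.exp (-(Complex.I * (((p - κ) * τ * t : ℝ) : ℂ))) / (t : ℂ) ^ 2)
        (Set.Ici 1) ∧
    auxA τ κ p =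
      Complex.I / 2 * (κ : ℂ) * (τ : ℂ) *
        (Complex.exp (Complex.I * (κ : ℂ) * (τ : ℂ)) *
            (∫ t in Set.Ici (1 : ℝ),
              Complex.exp (-(Complex.I * (((p + κ) * τ * t : ℝ) : ℂ))) / (t : ℂ) ^ 2) -
          Complex.exp (-(Complex.I * (κ : ℂ) * (τ : ℂ))) *
            (∫ t in Set.Ici (1 : ℝ),
              Complex.exp (-(Complex.I * (((p - κ) * τ * t : ℝ) : ℂ))) / (t : ℂ) ^ 2)) := by
  refine ⟨auxA_integrable _, auxA_integrable _, ?_⟩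
  have h1 := auxA_integrable ((p + κ) * τ)
  have h2 := auxA_integrable ((p - κ) * τ)
  rw [← integral_const_mul, ← integral_const_mul,
    ← integral_sub (h1.const_mul _) (h2.const_mul _), ← integral_const_mul,
    integral_Ici_eq_integral_Ioi]
  unfold auxA
  set f : ℝ → ℂ := fun t => ((κ * τ ^ 2 / t ^ 2 * Real.sin (κ * (τ - t)) : ℝ) : ℂ) *
      Complex.exp (-(Complex.I * (p : ℂ) * (t : ℂ))) with hf
  have hτ0 : -τ ≠ 0 := by linarith
  have a1 : ∫ t in Set.Iic τ, f t = ∫ t in Set.Ioi (-τ), f (-t) := by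
    have := integral_comp_neg_Iic τ (fun t => f (-t))
    simpa using this
  have a2 := integral_comp_mul_left_Ioi (fun t => f (-t)) 1 (neg_pos.2 hτ)
  rw [mul_one] at a2
  have a3 : ∫ t in Set.Ioi (-τ), f (-t) = (-τ) • ∫ t in Set.Ioi (1 : ℝ), f (-(-τ * t)) := by
    rw [a2, smul_smul, mul_inv_cancel₀ hτ0, one_smul]
  rw [a1, a3, ← integral_smul]
  refine setIntegral_congr_fun measurableSet_Ioi fun t ht => ?_
  have ht0 : (t : ℂ) ≠ 0 := by
    have : (0 : ℝ) < t := lt_trans one_pos ht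
    exact_mod_cast this.ne'
  have hτc : (τ : ℂ) ≠ 0 := by exact_mod_cast hτ.ne
  have e1 : Complex.exp (-(Complex.I * (((p + κ) * τ * t : ℝ) : ℂ))) =
      Complex.exp (-(Complex.I * κ * τ * t)) * Complex.exp (-(Complex.I * p * (τ * t))) := by
    rw [← Complex.exp_add]; congr 1; push_cast; ring
  have e2 : Complex.exp (-(Complex.I * (((p - κ) * τ * t : ℝ) : ℂ))) =
      Complex.exp (Complex.I * κ * τ * t) * Complex.exp (-(Complex.I * p * (τ * t))) := by
    rw [← Complex.exp_add]; congr 1; push_cast; ring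
  have e3 : Complex.sin (κ * (τ - τ * t)) =
      (Complex.exp (-(Complex.I * κ * τ)) * Complex.exp (Complex.I * κ * τ * t) -
       Complex.exp (Complex.I * κ * τ) * Complex.exp (-(Complex.I * κ * τ * t)))
        * Complex.I / 2 := by
    rw [Complex.sin, ← Complex.exp_add, ← Complex.exp_add]
    congr 4 <;> ring_nf
  have e4 : -(-τ * t) = τ * t := by ring
  simp only [hf, e1, e2, e4, Complex.real_smul]
  push_cast
  rw [e3]
  field_simp
  ring
end

section
/- Let H ≠ 0 and k > 0 be real numbers and let f : ℝ → ℝ be a smooth function whose support is compact and contained in the negative half-line {τ < 0}. Define u(τ) := ∫_{−∞}^τ ( −(1/(6H²)) · (τ² / t⁴) · (√3 / k) · sin( k (τ − t) / √3 ) ) · f(t) dt for τ < 0. Then u solves the mode equation of the trace-perturbation operator with the retarded Green's function: for every τ < 0, −6 H² τ⁴ · ( (d²/dτ²)(τ^{−2} u(τ)) + (k²/3) · τ^{−2} u(τ) ) = f(τ). -/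
open MeasureTheory Filter Real

theorem hasDerivAt_integral_Iic_aux (p : ℝ → ℝ) (hc : Continuous p) (hs : HasCompactSupport p)
    (x : ℝ) : HasDerivAt (fun s => ∫ t in Set.Iic s, p t) (p x) x := by
  have hi : Integrable p := hc.integrable_of_hasCompactSupport hs
  have h1 : (fun s => ∫ t in Set.Iic s, p t)
      = fun s => (∫ t in Set.Iic (0:ℝ), p t) + ∫ t in (0:ℝ)..s, p t := by
    funext s
    rw [← intervalIntegral.integral_Iic_sub_Iic hi.integrableOn hi.integrableOn]
    ring
  rw [h1]
  exact (hc.integral_hasStrictDerivAt 0 x).hasDerivAt.const_add _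

/-- Let `H ≠ 0`, `k > 0` and let `f` be a smooth function with compact support contained in
the negative half-line. If `u(τ) = ∫_{-∞}^τ (-(1/(6H²)) (τ²/t⁴) (√3/k) sin(k(τ-t)/√3)) f(t) dt`,
then `u` solves the Fourier-transformed trace-perturbation equation with the retarded Green's
function: for every `τ < 0`,
`-6H²τ⁴ ((d²/dτ²)(τ⁻²u(τ)) + (k²/3) τ⁻² u(τ)) = f(τ)`. -/
theorem retarded_green_solves (H k : ℝ) (hH : H ≠ 0) (hk : 0 < k)
    (f : ℝ → ℝ) (hf : ContDiff ℝ (⊤ : ℕ∞) f) (hsupp : HasCompactSupport f)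
    (hneg : tsupport f ⊆ Set.Iio 0)
    (u : ℝ → ℝ)
    (hu : ∀ τ : ℝ, τ < 0 →
      u τ = ∫ t in Set.Iic τ,
        (-(1 / (6 * H ^ 2)) * (τ ^ 2 / t ^ 4) * (Real.sqrt 3 / k) *
          Real.sin (k * (τ - t) / Real.sqrt 3)) * f t) :
    ∀ τ : ℝ, τ < 0 →
      -6 * H ^ 2 * τ ^ 4 *
          (deriv (deriv (fun s : ℝ => u s / s ^ 2)) τ + k ^ 2 / 3 * (u τ / τ ^ 2)) = f τ := by
  have hgc : Continuous (fun t => f t / t ^ 4) := by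
    rw [continuous_iff_continuousAt]
    intro t
    by_cases ht : t = 0
    · have h0 : t ∉ tsupport f := fun h => by
        have := hneg h
        simp [ht] at this
      have h1 : (fun t => f t / t ^ 4) =ᶠ[nhds t] fun _ => (0:ℝ) := by
        filter_upwards [notMem_tsupport_iff_eventuallyEq.mp h0] with s hs
        simp [hs]
      exact continuousAt_const.congr h1.symm
    · exact hf.continuous.continuousAt.div (by fun_prop) (pow_ne_zero _ ht)
  have hgs : HasCompactSupport (fun t => f t / t ^ 4) := by
    simp only [div_eq_mul_inv]
    exact hsupp.mul_right
  have h3 : Real.sqrt 3 ^ 2 = 3 := Real.sq_sqrt (by norm_num)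
  have h3' : Real.sqrt 3 ≠ 0 := by positivity
  obtain ⟨w, hw⟩ : ∃ w, w = k / Real.sqrt 3 := ⟨_, rfl⟩
  have hw0 : w ≠ 0 := by rw [hw]; positivity
  have hw2 : k ^ 2 / 3 = w ^ 2 := by rw [hw, div_pow, h3]
  have hwi : Real.sqrt 3 / k = 1 / w := by rw [hw]; field_simp
  set g : ℝ → ℝ := fun t => f t / t ^ 4 with hg
  have hpc : Continuous (fun t => Real.cos (w * t) * g t) := by fun_prop
  have hps : HasCompactSupport (fun t => Real.cos (w * t) * g t) := hgs.mul_left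
  have hqc : Continuous (fun t => Real.sin (w * t) * g t) := by fun_prop
  have hqs : HasCompactSupport (fun t => Real.sin (w * t) * g t) := hgs.mul_left
  have hA := hasDerivAt_integral_Iic_aux _ hpc hps
  have hB := hasDerivAt_integral_Iic_aux _ hqc hqs
  have hpi := hpc.integrable_of_hasCompactSupport (μ := volume) hps
  have hqi := hqc.integrable_of_hasCompactSupport (μ := volume) hqs
  set A : ℝ → ℝ := fun s => ∫ t in Set.Iic s, Real.cos (w * t) * g t with hAd
  set B : ℝ → ℝ := fun s => ∫ t in Set.Iic s, Real.sin (w * t) * g t with hBd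
  obtain ⟨c, hc⟩ : ∃ c, c = -(1 / (6 * H ^ 2)) * (1 / w) := ⟨_, rfl⟩
  have hv : ∀ s : ℝ, s < 0 →
      u s / s ^ 2 = c * (Real.sin (w * s) * A s - Real.cos (w * s) * B s) := by
    intro s hs
    have hs0 : s ≠ 0 := hs.ne
    rw [hu s hs]
    simp only [hAd, hBd]
    rw [← integral_const_mul, ← integral_const_mul,
      ← integral_sub (hpi.integrableOn.const_mul _) (hqi.integrableOn.const_mul _),
      ← integral_const_mul, ← integral_div]
    congr 1
    funext t
    have e : k * (s - t) / Real.sqrt 3 = w * s - w * t := by rw [hw]; ring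
    rw [e, Real.sin_sub, hwi, hc, hg]
    field_simp
  have hsin : ∀ s : ℝ, HasDerivAt (fun s => Real.sin (w * s)) (Real.cos (w * s) * w) s := by
    intro s
    simpa using ((hasDerivAt_id s).const_mul w).sin
  have hcos : ∀ s : ℝ, HasDerivAt (fun s => Real.cos (w * s)) (-Real.sin (w * s) * w) s := by
    intro s
    simpa using ((hasDerivAt_id s).const_mul w).cos
  have hd1 : ∀ s : ℝ, s < 0 → deriv (fun s : ℝ => u s / s ^ 2) s
      = c * w * (Real.cos (w * s) * A s + Real.sin (w * s) * B s) := by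
    intro s hs
    have he : (fun s : ℝ => u s / s ^ 2) =ᶠ[nhds s]
        fun s => c * (Real.sin (w * s) * A s - Real.cos (w * s) * B s) := by
      filter_upwards [Iio_mem_nhds hs] with r hr
      exact hv r hr
    rw [he.deriv_eq]
    refine ((((hsin s).mul (hA s)).sub ((hcos s).mul (hB s))).const_mul c).deriv.trans ?_
    ring
  intro τ hτ
  have he : deriv (fun s : ℝ => u s / s ^ 2) =ᶠ[nhds τ]
      fun s => c * w * (Real.cos (w * s) * A s + Real.sin (w * s) * B s) := by
    filter_upwards [Iio_mem_nhds hτ] with r hr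
    exact hd1 r hr
  have hd2 : deriv (deriv (fun s : ℝ => u s / s ^ 2)) τ
      = c * w * (-w * (Real.sin (w * τ) * A τ - Real.cos (w * τ) * B τ) + g τ) := by
    rw [he.deriv_eq]
    refine ((((hcos τ).mul (hA τ)).add ((hsin τ).mul (hB τ))).const_mul (c * w)).deriv.trans ?_
    have := Real.sin_sq_add_cos_sq (w * τ)
    linear_combination (c * w * g τ) * this
  rw [hd2, hv τ hτ, hw2]
  have hτ0 : τ ≠ 0 := hτ.ne
  have e1 : c * w = -(1 / (6 * H ^ 2)) := by rw [hc]; field_simp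
  have e2 : c * w * (-w * (Real.sin (w * τ) * A τ - Real.cos (w * τ) * B τ) + g τ)
      + w ^ 2 * (c * (Real.sin (w * τ) * A τ - Real.cos (w * τ) * B τ)) = c * w * g τ := by ring
  rw [e2, e1, hg]
  field_simp
end

section
/- For every ε > 0 and all points (τ₁, x⃗₁), (τ₂, x⃗₂) in ℝ × ℝ³, writing σ_M := −(τ₁ − τ₂)² + |x⃗₁ − x⃗₂|², the square of the massless Minkowski vacuum two-point function has the spatial Fourier representation ( (1/(4π²)) · 1/(σ_M + 2 i ε (τ₁ − τ₂) + ε²) )² = (1/(128 π⁵)) · ∫_{ℝ³} e^{i k⃗·(x⃗₁ − x⃗₂)} · ( ∫_{|k⃗|}^∞ e^{−i p (τ₁ − τ₂)} · e^{−ε p} dp ) d³k⃗, where the denominator σ_M + 2iε(τ₁ − τ₂) + ε² is nonzero and both iterated integrals converge absolutely. -/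
open MeasureTheory Filter Real Complex
open scoped RealInnerProductSpace

lemma aux_tendsto (a b w : ℂ) (hw : 0 < w.re) :
    Tendsto (fun s : ℝ => (a * s + b) * cexp (-(w * s))) atTop (nhds 0) := by
  rw [tendsto_zero_iff_norm_tendsto_zero]
  have h1 : Tendsto (fun s : ℝ => s * Real.exp (-w.re * s)) atTop (nhds 0) := by
    simpa using tendsto_rpow_mul_exp_neg_mul_atTop_nhds_zero 1 w.re hw
  have h0 : Tendsto (fun s : ℝ => Real.exp (-w.re * s)) atTop (nhds 0) := by
    simpa using tendsto_rpow_mul_exp_neg_mul_atTop_nhds_zero 0 w.re hw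
  have h2 := (h1.const_mul ‖a‖).add (h0.const_mul ‖b‖)
  simp only [mul_zero, add_zero] at h2
  refine squeeze_zero' (Eventually.of_forall fun _ => norm_nonneg _) ?_ h2
  filter_upwards [eventually_ge_atTop 0] with s hs
  have : ‖a * s + b‖ ≤ ‖a‖ * s + ‖b‖ := by
    refine (norm_add_le _ _).trans ?_
    simp [abs_of_nonneg hs]
  rw [norm_mul, Complex.norm_exp]
  have e : (-(w * (s:ℂ))).re = -w.re * s := by simp
  rw [e]
  calc _ ≤ (‖a‖ * s + ‖b‖) * Real.exp (-w.re * s) := by gcongr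
    _ = _ := by ring

lemma aux_int (n : ℕ) (c : ℝ) (hc : 0 < c) :
    IntegrableOn (fun y : ℝ => y ^ n * Real.exp (-c * y)) (Set.Ioi 0) := by
  have := integrableOn_rpow_mul_exp_neg_mul_rpow (p := 1) (s := n) (b := c)
    (by have : (0:ℝ) ≤ n := Nat.cast_nonneg n
        linarith) one_pos hc
  simpa using this

lemma aux_halfline (a b w : ℂ) (hw : 0 < w.re) :
    IntegrableOn (fun s : ℝ => (a * s + b) * cexp (-(w * s))) (Set.Ioi 0) ∧
    ∫ s in Set.Ioi (0:ℝ), (a * s + b) * cexp (-(w * s)) = a / w ^ 2 + b / w := by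
  have hw0 : w ≠ 0 := by rintro rfl; simp at hw
  have hi : IntegrableOn (fun s : ℝ => (a * s + b) * cexp (-(w * s))) (Set.Ioi 0) := by
    have h2 := ((aux_int 1 w.re hw).const_mul ‖a‖).add ((aux_int 0 w.re hw).const_mul ‖b‖)
    refine Integrable.mono' h2 (by fun_prop) ?_
    refine (ae_restrict_iff' measurableSet_Ioi).2 (Eventually.of_forall fun s hs => ?_)
    have hs : 0 < s := hs
    have : ‖a * s + b‖ ≤ ‖a‖ * s + ‖b‖ := by
      refine (norm_add_le _ _).trans ?_
      simp [abs_of_nonneg hs.le]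
    rw [norm_mul, Complex.norm_exp]
    have e : (-(w * (s:ℂ))).re = -w.re * s := by simp
    rw [e]
    calc _ ≤ (‖a‖ * s + ‖b‖) * Real.exp (-w.re * s) := by gcongr
      _ = _ := by simp; ring
  refine ⟨hi, ?_⟩
  rw [integral_Ioi_of_hasDerivAt_of_tendsto' (m := 0)
    (f := fun s : ℝ => ((-a / w) * s + (-a / w ^ 2 - b / w)) * cexp (-(w * s))) ?_ hi
    (aux_tendsto _ _ w hw)]
  · simp; ring
  · intro s _
    have h1 : HasDerivAt (fun s : ℝ => (s : ℂ)) 1 s := Complex.ofRealCLM.hasDerivAt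
    convert! ((h1.const_mul (-a / w)).add_const (-a / w ^ 2 - b / w)).mul
      ((h1.const_mul w).neg.cexp) using 1
    simp only [Pi.neg_apply]
    field_simp
    ring

lemma aux_radial (z : ℂ) (hz : 0 < z.re) (a : ℝ) :
    ∫ y in Set.Ioi (0:ℝ), (y : ℂ) * cexp (-(z * ((√(a ^ 2 + y ^ 2) : ℝ) : ℂ))) =
      (|a| / z + 1 / z ^ 2) * cexp (-(z * |a|)) := by
  have hz0 : z ≠ 0 := by rintro rfl; simp at hz
  rw [integral_Ioi_of_hasDerivAt_of_tendsto (m := 0)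
    (f := fun y : ℝ => ((-1 / z) * ((√(a ^ 2 + y ^ 2) : ℝ) : ℂ) + (-1 / z ^ 2)) *
      cexp (-(z * ((√(a ^ 2 + y ^ 2) : ℝ) : ℂ))))]
  · simp [Real.sqrt_sq_eq_abs]; ring
  · apply Continuous.continuousWithinAt
    fun_prop
  · intro y hy
    have hy : 0 < y := hy
    have hp : 0 < a ^ 2 + y ^ 2 := by positivity
    have hs : √(a ^ 2 + y ^ 2) ≠ 0 := (Real.sqrt_pos.2 hp).ne'
    have h0 : HasDerivAt (fun y : ℝ => √(a ^ 2 + y ^ 2)) (y / √(a ^ 2 + y ^ 2)) y := by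
      convert (((hasDerivAt_pow 2 y).const_add (a ^ 2)).sqrt hp.ne') using 1
      field_simp
      simp [mul_comm]
    have h1 := h0.ofReal_comp
    have hs' : ((√(a ^ 2 + y ^ 2) : ℝ) : ℂ) ≠ 0 := by exact_mod_cast hs
    convert! ((h1.const_mul (-1 / z)).add_const (-1 / z ^ 2)).mul
      ((h1.const_mul z).neg.cexp) using 1
    simp only [Pi.neg_apply]
    push_cast
    field_simp
    ring
  · have h2 := (aux_int 1 z.re hz)
    refine Integrable.mono' h2 (by fun_prop) ?_
    refine (ae_restrict_iff' measurableSet_Ioi).2 (Eventually.of_forall fun s hs => ?_)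
    have hs : 0 < s := hs
    have h3 : s ≤ √(a ^ 2 + s ^ 2) := Real.le_sqrt_of_sq_le (by nlinarith [sq_nonneg a])
    rw [norm_mul, Complex.norm_exp]
    have e : (-(z * ((√(a ^ 2 + s ^ 2) : ℝ) : ℂ))).re = -z.re * √(a ^ 2 + s ^ 2) := by simp
    rw [e]
    simp only [Complex.norm_real, Real.norm_eq_abs, abs_of_pos hs, pow_one]
    gcongr ?_ * Real.exp ?_
    nlinarith
  · refine (aux_tendsto (-1 / z) (-1 / z ^ 2) z hz).comp (?_ : Tendsto (fun y : ℝ => √(a ^ 2 + y ^ 2)) atTop atTop)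
    refine tendsto_atTop_mono' _ ?_ tendsto_id
    filter_upwards with s
    exact Real.le_sqrt_of_sq_le (by simp; nlinarith [sq_nonneg a])

lemma aux_plane (z : ℂ) (hz : 0 < z.re) (a : ℝ) :
    ∫ v : EuclideanSpace ℝ (Fin 2), cexp (-(z * ((√(a ^ 2 + ‖v‖ ^ 2) : ℝ) : ℂ))) =
      2 * π * ((|a| / z + 1 / z ^ 2) * cexp (-(z * |a|))) := by
  rw [integral_fun_norm_addHaar volume (fun y : ℝ => cexp (-(z * ((√(a ^ 2 + y ^ 2) : ℝ) : ℂ))))]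
  rw [← aux_radial z hz a]
  simp [Measure.real, InnerProductSpace.volume_ball_of_dim_even (E := EuclideanSpace ℝ (Fin 2)) (k := 1) (by simp), pi_nonneg]
  ring

lemma aux_line (z : ℂ) (hz : 0 < z.re) (r : ℝ) :
    ∫ a : ℝ, cexp (I * ((a * r : ℝ) : ℂ)) * (2 * π * ((|a| / z + 1 / z ^ 2) * cexp (-(z * |a|)))) =
      8 * π * z / (z ^ 2 + r ^ 2) ^ 2 := by
  have hz0 : z ≠ 0 := by rintro rfl; simp at hz
  have hp : 0 < (z + I * r).re := by simpa using hz
  have hm : 0 < (z - I * r).re := by simpa using hz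
  have hp0 : z + I * r ≠ 0 := by intro h; simp [h] at hp
  have hm0 : z - I * r ≠ 0 := by intro h; simp [h] at hm
  obtain ⟨i1, e1⟩ := aux_halfline (2 * π / z) (2 * π / z ^ 2) _ hm
  obtain ⟨i2, e2⟩ := aux_halfline (2 * π / z) (2 * π / z ^ 2) _ hp
  set f : ℝ → ℂ := fun a => cexp (I * ((a * r : ℝ) : ℂ)) *
    (2 * π * ((|a| / z + 1 / z ^ 2) * cexp (-(z * |a|)))) with hf
  have c1 : ∀ s ∈ Set.Ioi (0:ℝ), (2 * π / z * s + 2 * π / z ^ 2) * cexp (-((z - I * r) * s)) = f s := by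
    intro s hs
    have hs : 0 < s := hs
    simp only [hf, abs_of_pos hs]
    rw [show -((z - I * r) * (s:ℂ)) = I * ((s * r : ℝ) : ℂ) + -(z * s) by push_cast; ring, Complex.exp_add]
    ring
  have c2 : ∀ s ∈ Set.Ioi (0:ℝ), (2 * π / z * s + 2 * π / z ^ 2) * cexp (-((z + I * r) * s)) = f (-s) := by
    intro s hs
    have hs : 0 < s := hs
    simp only [hf, abs_neg, abs_of_pos hs]
    rw [show -((z + I * r) * (s:ℂ)) = I * ((-s * r : ℝ) : ℂ) + -(z * s) by push_cast; ring, Complex.exp_add]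
    ring
  have j1 : IntegrableOn f (Set.Ioi 0) := i1.congr_fun c1 measurableSet_Ioi
  have j2 : IntegrableOn (fun s => f (-s)) (Set.Ioi 0) := i2.congr_fun c2 measurableSet_Ioi
  have j3 : IntegrableOn f (Set.Iic 0) := by
    have := ((integrableOn_Ici_iff_integrableOn_Ioi (by simp)).2 j2)
    have h := (Measure.measurePreserving_neg (volume : Measure ℝ)).integrableOn_comp_preimage
      (Homeomorph.neg ℝ).measurableEmbedding (f := f) (s := Set.Iic 0)
    rw [← h]
    simpa [Function.comp_def] using this
  rw [setIntegral_congr_fun measurableSet_Ioi c1] at e1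
  rw [setIntegral_congr_fun measurableSet_Ioi c2, integral_comp_neg_Ioi, neg_zero] at e2
  rw [← intervalIntegral.integral_Iic_add_Ioi j3 j1, e1, e2]
  have hD : z ^ 2 + r ^ 2 = (z + I * r) * (z - I * r) := by
    linear_combination ((r:ℂ)^2) * I_sq
  rw [hD]
  field_simp
  ring

abbrev E3 := EuclideanSpace ℝ (Fin 3)
abbrev E12 := WithLp 2 (ℝ × EuclideanSpace ℝ (Fin 2))

lemma aux_iso (x : E3) : ∃ U : E3 ≃ₗᵢ[ℝ] E12, U x = WithLp.toLp 2 (‖x‖, 0) := by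
  have hfin : Module.finrank ℝ E12 = 3 := by
    rw [(WithLp.linearEquiv 2 ℝ (ℝ × EuclideanSpace ℝ (Fin 2))).finrank_eq]
    simp
  let V : E3 ≃ₗᵢ[ℝ] E12 := ((stdOrthonormalBasis ℝ E12).reindex (finCongr hfin)).repr.symm
  have h : ‖V x‖ = ‖(WithLp.toLp 2 (‖x‖, 0) : E12)‖ := by
    rw [V.norm_map, WithLp.prod_norm_eq_of_L2]
    simp
  exact ⟨V.trans (Submodule.reflection (Submodule.span ℝ {V x - WithLp.toLp 2 (‖x‖, 0)})ᗮ),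
    Submodule.reflection_sub h⟩

lemma aux_integrable_s17 (z : ℂ) (hz : 0 < z.re) (x : E3) :
    Integrable (fun k : E3 => cexp (I * ((⟪k, x⟫ : ℝ) : ℂ)) * cexp (-(z * ‖k‖))) := by
  have h : Integrable (fun k : E3 => Real.exp (-z.re * ‖k‖)) := by
    rw [integrable_fun_norm_addHaar volume (f := fun y => Real.exp (-z.re * y))]
    simpa using aux_int 2 z.re hz
  refine h.mono' (by fun_prop) (Eventually.of_forall fun k => ?_)
  simp [Complex.norm_exp]

lemma aux_main (z : ℂ) (hz : 0 < z.re) (x : E3) :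
    ∫ k : E3, cexp (I * ((⟪k, x⟫ : ℝ) : ℂ)) * cexp (-(z * ‖k‖)) =
      8 * π * z / (z ^ 2 + ‖x‖ ^ 2) ^ 2 := by
  obtain ⟨U, hU⟩ := aux_iso x
  have hI := aux_integrable_s17 z hz x
  have mp : MeasurePreserving
      (fun q : ℝ × EuclideanSpace ℝ (Fin 2) => U.symm (WithLp.toLp 2 q)) :=
    U.symm.measurePreserving.comp (WithLp.volume_preserving_toLp ℝ (EuclideanSpace ℝ (Fin 2)))
  have me : MeasurableEmbedding
      (fun q : ℝ × EuclideanSpace ℝ (Fin 2) => U.symm (WithLp.toLp 2 q)) :=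
    U.symm.toMeasurableEquiv.measurableEmbedding.comp
      (MeasurableEquiv.toLp 2 (ℝ × EuclideanSpace ℝ (Fin 2))).measurableEmbedding
  have key : ∀ q : ℝ × EuclideanSpace ℝ (Fin 2),
      cexp (I * ((⟪U.symm (WithLp.toLp 2 q), x⟫ : ℝ) : ℂ)) *
        cexp (-(z * ‖U.symm (WithLp.toLp 2 q)‖)) =
      cexp (I * ((q.1 * ‖x‖ : ℝ) : ℂ)) * cexp (-(z * ((√(q.1 ^ 2 + ‖q.2‖ ^ 2) : ℝ) : ℂ))) := by
    intro q
    have h1 : ⟪U.symm (WithLp.toLp 2 q), x⟫ = q.1 * ‖x‖ := by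
      rw [← U.inner_map_map, hU, U.apply_symm_apply, WithLp.prod_inner_apply]
      simp [mul_comm]
    rw [h1, U.symm.norm_map, WithLp.prod_norm_eq_of_L2]
    simp
  have hI2 := (mp.integrable_comp_emb me).2 hI
  rw [← mp.integral_comp me]
  simp only [Function.comp_def, key] at hI2 ⊢
  rw [Measure.volume_eq_prod] at hI2 ⊢
  rw [integral_prod _ hI2, ← aux_line z hz ‖x‖]
  congr 1 with a
  simp only []
  rw [integral_const_mul, aux_plane z hz a]

/-- For every `ε > 0` and all points `(τ₁, x⃗₁), (τ₂, x⃗₂)` of `ℝ × ℝ³`, with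
`σ_M = -(τ₁-τ₂)² + |x⃗₁-x⃗₂|²`, the denominator `σ_M + 2iε(τ₁-τ₂) + ε²` is nonzero, both
iterated integrals converge absolutely, and the square of the regularized massless Minkowski
vacuum two-point function has the spatial Fourier representation
`((1/(4π²)) (σ_M + 2iε(τ₁-τ₂) + ε²)⁻¹)²
  = (1/(128π⁵)) ∫_{ℝ³} e^{ik⃗·(x⃗₁-x⃗₂)} ∫_{|k⃗|}^∞ e^{-ip(τ₁-τ₂)} e^{-εp} dp d³k⃗`. -/
theorem minkowski_vacuum_squared_fourier (ε : ℝ) (hε : 0 < ε)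
    (τ₁ τ₂ : ℝ) (x₁ x₂ : EuclideanSpace ℝ (Fin 3)) :
    ((((-(τ₁ - τ₂) ^ 2 + ‖x₁ - x₂‖ ^ 2 : ℝ) : ℂ) +
        2 * Complex.I * (ε : ℂ) * ((τ₁ - τ₂ : ℝ) : ℂ) + (ε : ℂ) ^ 2) ≠ 0) ∧
    (∀ k : EuclideanSpace ℝ (Fin 3),
      MeasureTheory.IntegrableOn
        (fun p : ℝ =>
          Complex.exp (-(Complex.I * (p : ℂ) * ((τ₁ - τ₂ : ℝ) : ℂ))) *
            ((Real.exp (-(ε * p)) : ℝ) : ℂ))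
        (Set.Ioi ‖k‖)) ∧
    MeasureTheory.Integrable
      (fun k : EuclideanSpace ℝ (Fin 3) =>
        Complex.exp (Complex.I * ((⟪k, x₁ - x₂⟫ : ℝ) : ℂ)) *
          ∫ p in Set.Ioi ‖k‖,
            Complex.exp (-(Complex.I * (p : ℂ) * ((τ₁ - τ₂ : ℝ) : ℂ))) *
              ((Real.exp (-(ε * p)) : ℝ) : ℂ)) ∧
    (((1 / (4 * Real.pi ^ 2) : ℝ) : ℂ) *
          ((((-(τ₁ - τ₂) ^ 2 + ‖x₁ - x₂‖ ^ 2 : ℝ) : ℂ) +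
            2 * Complex.I * (ε : ℂ) * ((τ₁ - τ₂ : ℝ) : ℂ) + (ε : ℂ) ^ 2))⁻¹) ^ 2 =
      ((1 / (128 * Real.pi ^ 5) : ℝ) : ℂ) *
        ∫ k : EuclideanSpace ℝ (Fin 3),
          Complex.exp (Complex.I * ((⟪k, x₁ - x₂⟫ : ℝ) : ℂ)) *
            ∫ p in Set.Ioi ‖k‖,
              Complex.exp (-(Complex.I * (p : ℂ) * ((τ₁ - τ₂ : ℝ) : ℂ))) *
                ((Real.exp (-(ε * p)) : ℝ) : ℂ) := by
  
  set t : ℝ := τ₁ - τ₂ with ht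
  set x := x₁ - x₂ with hx
  set z : ℂ := ε + I * t with hzdef
  have hz : 0 < z.re := by simpa [hzdef] using hε
  have hz0 : z ≠ 0 := by intro h; simp [h] at hz
  have hD : (((-t ^ 2 + ‖x‖ ^ 2 : ℝ) : ℂ) + 2 * Complex.I * (ε : ℂ) * (t : ℂ) + (ε : ℂ) ^ 2)
      = z ^ 2 + ‖x‖ ^ 2 := by
    rw [hzdef]
    push_cast
    linear_combination (-(t : ℂ) ^ 2) * I_sq
  have hD0 : z ^ 2 + (‖x‖ : ℂ) ^ 2 ≠ 0 := by
    have e : z ^ 2 + (‖x‖ : ℂ) ^ 2 = (z + I * ‖x‖) * (z - I * ‖x‖) := by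
      linear_combination ((‖x‖ : ℂ) ^ 2) * I_sq
    rw [e]
    refine mul_ne_zero (fun h => ?_) (fun h => ?_)
    · have := congrArg Complex.re h
      simp at this
      linarith
    · have := congrArg Complex.re h
      simp at this
      linarith
  have hp : ∀ p : ℝ, Complex.exp (-(Complex.I * (p : ℂ) * (t : ℂ))) *
      ((Real.exp (-(ε * p)) : ℝ) : ℂ) = cexp (-z * p) := by
    intro p
    rw [Complex.ofReal_exp, ← Complex.exp_add, hzdef]
    congr 1
    push_cast
    ring
  have hnz : (-z).re < 0 := by simpa using hz
  simp only [hp, hD, integral_exp_mul_complex_Ioi hnz]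
  have hk : ∀ k : E3, cexp (I * ((⟪k, x⟫ : ℝ) : ℂ)) * (-cexp (-z * ‖k‖) / -z) =
      (1 / z) * (cexp (I * ((⟪k, x⟫ : ℝ) : ℂ)) * cexp (-(z * ‖k‖))) := by
    intro k
    rw [neg_mul, neg_div_neg_eq]
    ring
  simp only [hk]
  refine ⟨hD0, fun k => integrableOn_exp_mul_complex_Ioi hnz _,
    (aux_integrable_s17 z hz x).const_mul _, ?_⟩
  rw [integral_const_mul, aux_main z hz x]
  have hpi : (π : ℂ) ≠ 0 := by exact_mod_cast pi_ne_zero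
  push_cast
  field_simp
  norm_num
end

section
/- Let τ < 0, m > 0 and let k⃗₁, k⃗₂, k⃗₃ ∈ ℝ³ be nonzero vectors. Define, for ε > 0, the regularized bispectrum B₀^ε(τ, k⃗₁, k⃗₂, k⃗₃) := (m⁶ / (32√3 · k₁² k₂² k₃²)) · ∫_{ℝ³} Σ_π [ e^{−ε(ω_p⃗(−k⃗_{π(1)}) + ω_p⃗(k⃗_{π(3)}) + |p⃗|)} / (ω_p⃗(−k⃗_{π(1)}) · ω_p⃗(k⃗_{π(3)}) · |p⃗|) ] · A(τ, k_{π(1)}/√3, ω_p⃗(−k⃗_{π(1)}) + |p⃗|) · A(τ, k_{π(3)}/√3, −ω_p⃗(k⃗_{π(3)}) − |p⃗|) · A(τ, k_{π(2)}/√3, ω_p⃗(k⃗_{π(3)}) − ω_p⃗(−k⃗_{π(1)})) d³p⃗, where the sum ranges over the six permutations π of {1,2,3}, ω_p⃗(k⃗) := |k⃗ + p⃗| and k_i := |k⃗_i|, and let B₀(τ, k⃗₁, k⃗₂, k⃗₃) := lim_{ε→0⁺} B₀^ε(τ, k⃗₁, k⃗₂, k⃗₃). Then for every λ > 0, B₀(λτ,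 k⃗₁/λ, k⃗₂/λ, k⃗₃/λ) = λ⁶ · B₀(τ, k⃗₁, k⃗₂, k⃗₃); equivalently, k₁² k₂² k₃² · B₀(τ, k⃗₁, k⃗₂, k⃗₃) is invariant under the simultaneous rescaling (τ, k⃗₁, k⃗₂, k⃗₃) ↦ (λτ, k⃗₁/λ, k⃗₂/λ, k⃗₃/λ). -/
open MeasureTheory Filter Real Complex

/-- The regularized leading contribution `B₀^ε` to the bispectrum of the Bardeen potential,
where `ω_p⃗(k⃗) = |k⃗ + p⃗|` (so `ω_p⃗(-k⃗) = |p⃗ - k⃗|`) and the sum ranges over the six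
permutations of the three momenta. -/
noncomputable def B0eps (m τ : ℝ) (k1 k2 k3 : EuclideanSpace ℝ (Fin 3)) (ε : ℝ) : ℂ :=
  ((m ^ 6 / (32 * Real.sqrt 3 * (‖k1‖ ^ 2 * ‖k2‖ ^ 2 * ‖k3‖ ^ 2)) : ℝ) : ℂ) *
    ∫ p : EuclideanSpace ℝ (Fin 3),
      ∑ σ : Equiv.Perm (Fin 3),
        (((Real.exp (-(ε * (‖p - ![k1, k2, k3] (σ 0)‖ + ‖![k1, k2, k3] (σ 2) + p‖ + ‖p‖))) /
            (‖p - ![k1, k2, k3] (σ 0)‖ * ‖![k1, k2, k3] (σ 2) + p‖ * ‖p‖) : ℝ)) : ℂ) *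
          auxA τ (‖![k1, k2, k3] (σ 0)‖ / Real.sqrt 3)
            (‖p - ![k1, k2, k3] (σ 0)‖ + ‖p‖) *
          auxA τ (‖![k1, k2, k3] (σ 2)‖ / Real.sqrt 3)
            (-(‖![k1, k2, k3] (σ 2) + p‖ + ‖p‖)) *
          auxA τ (‖![k1, k2, k3] (σ 1)‖ / Real.sqrt 3)
            (‖![k1, k2, k3] (σ 2) + p‖ - ‖p - ![k1, k2, k3] (σ 0)‖)

/-- The leading contribution `B₀` to the bispectrum, defined as the limit `ε → 0⁺`
of the regularized bispectrum `B₀^ε`. -/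
noncomputable def B0 (m τ : ℝ) (k1 k2 k3 : EuclideanSpace ℝ (Fin 3)) : ℂ :=
  limUnder (nhdsWithin (0 : ℝ) (Set.Ioi 0)) (fun ε => B0eps m τ k1 k2 k3 ε)


lemma auxA_scale (τ κ q l : ℝ) (hl : 0 < l) :
    auxA (l * τ) (l⁻¹ * κ) (l⁻¹ * q) = auxA τ κ q := by
  unfold auxA
  rw [← integral_indicator measurableSet_Iic, ← integral_indicator measurableSet_Iic]
  set F : ℝ → ℂ := (Set.Iic (l * τ)).indicator (fun t : ℝ =>
    ((l⁻¹ * κ * (l * τ) ^ 2 / t ^ 2 * Real.sin (l⁻¹ * κ * (l * τ - t)) : ℝ) : ℂ) *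
      Complex.exp (-(Complex.I * ((l⁻¹ * q : ℝ) : ℂ) * (t : ℂ)))) with hF
  have h := Measure.integral_comp_mul_left F l
  have h2 : ∫ x, F x = (l : ℂ) * ∫ x, F (l * x) := by
    rw [h, abs_of_pos (inv_pos.mpr hl), Complex.real_smul, ← mul_assoc, ← Complex.ofReal_mul,
      mul_inv_cancel₀ hl.ne']
    simp
  rw [h2, ← integral_const_mul]
  congr 1
  ext t
  by_cases ht : t ≤ τ
  · have h3 : l * t ≤ l * τ := mul_le_mul_of_nonneg_left ht hl.le
    have e1 : l⁻¹ * κ * (l * τ - l * t) = κ * (τ - t) := by field_simp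
    have e2 : l⁻¹ * κ * (l * τ) ^ 2 / (l * t) ^ 2 = l⁻¹ * (κ * τ ^ 2 / t ^ 2) := by
      rw [mul_pow, mul_pow, mul_left_comm, mul_div_mul_left _ _ (pow_ne_zero 2 hl.ne')]
      ring
    have hlc : (l : ℂ) ≠ 0 := by exact_mod_cast hl.ne'
    have e3 : -(Complex.I * ((l⁻¹ * q : ℝ) : ℂ) * ((l * t : ℝ) : ℂ)) = -(Complex.I * q * t) := by
      push_cast; field_simp
    rw [hF, Set.indicator_of_mem (by exact h3), Set.indicator_of_mem (by exact ht), e1, e2, e3,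
      ← mul_assoc, ← Complex.ofReal_mul]
    congr 2
    field_simp
  · have h3 : ¬ l * t ≤ l * τ := fun h => ht (le_of_mul_le_mul_left h hl)
    rw [hF, Set.indicator_of_notMem (by exact h3), Set.indicator_of_notMem (by exact ht), mul_zero]

lemma pow_pos_of_neg_aux (τ : ℝ) (hτ : τ < 0) : 0 < τ ^ 2 := by nlinarith

lemma integrableOn_Iic_of_bound (τ : ℝ) (hτ : τ < 0) {E : Type*} [NormedAddCommGroup E]
    (f : ℝ → E) (hf : ContinuousOn f (Set.Iic τ)) (C : ℝ)
    (hb : ∀ t ≤ τ, ‖f t‖ ≤ C / t ^ 2) : IntegrableOn f (Set.Iic τ) := by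
  have hC : 0 ≤ C := by
    have := (norm_nonneg _).trans (hb τ le_rfl)
    have h2 : 0 < τ ^ 2 := pow_pos_of_neg_aux τ hτ
    by_contra h
    exact absurd this (not_le.mpr (div_neg_of_neg_of_pos (not_le.mp h) h2))
  have hi : IntegrableOn (fun t : ℝ => C * (1 + 1 / τ ^ 2) * (1 + t ^ 2)⁻¹) (Set.Iic τ) :=
    (integrable_inv_one_add_sq.const_mul _).integrableOn
  refine Integrable.mono' hi (hf.aestronglyMeasurable measurableSet_Iic) ?_
  refine (ae_restrict_iff' measurableSet_Iic).mpr (Eventually.of_forall fun t ht => ?_)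
  have ht' : t ≤ τ := ht
  refine (hb t ht').trans ?_
  have h1 : 0 < t ^ 2 := by nlinarith
  have h3 : 0 < τ ^ 2 := pow_pos_of_neg_aux τ hτ
  have h2 : τ ^ 2 ≤ t ^ 2 := by nlinarith
  rw [← div_eq_mul_inv, div_le_div_iff₀ h1 (by positivity), mul_assoc]
  refine mul_le_mul_of_nonneg_left ?_ hC
  have : 1 ≤ t ^ 2 / τ ^ 2 := by rwa [one_le_div h3]
  have e : (1 + 1 / τ ^ 2) * t ^ 2 = t ^ 2 + t ^ 2 / τ ^ 2 := by ring
  rw [e]; linarith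

lemma norm_cexp_aux (q t : ℝ) : ‖Complex.exp (-(Complex.I * (q : ℂ) * (t : ℂ)))‖ = 1 := by
  have : -(Complex.I * (q : ℂ) * (t : ℂ)) = ((-(q * t) : ℝ) : ℂ) * Complex.I := by
    push_cast; ring
  rw [this, Complex.norm_exp_ofReal_mul_I]

noncomputable def gA (τ κ t : ℝ) : ℝ := κ * τ ^ 2 / t ^ 2 * Real.sin (κ * (τ - t))

noncomputable def gA' (τ κ t : ℝ) : ℝ :=
  -(2 * κ * τ ^ 2) / t ^ 3 * Real.sin (κ * (τ - t))
    + κ * τ ^ 2 / t ^ 2 * (Real.cos (κ * (τ - t)) * (-κ))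

lemma gA_bound (τ κ t : ℝ) : |gA τ κ t| ≤ |κ| * τ ^ 2 / t ^ 2 := by
  unfold gA
  rw [abs_mul, abs_div, abs_mul, abs_of_nonneg (sq_nonneg τ), abs_of_nonneg (sq_nonneg t)]
  exact mul_le_of_le_one_right (by positivity) (Real.abs_sin_le_one _)

lemma gA'_bound (τ κ t : ℝ) (hτ : τ < 0) (ht : t ≤ τ) :
    |gA' τ κ t| ≤ (2 * |κ| * |τ| + κ ^ 2 * τ ^ 2) / t ^ 2 := by
  have ht0 : t < 0 := ht.trans_lt hτ
  have h1 : |-(2 * κ * τ ^ 2) / t ^ 3 * Real.sin (κ * (τ - t))| ≤ 2 * |κ| * |τ| / t ^ 2 := by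
    rw [abs_mul]
    refine (mul_le_of_le_one_right (by positivity) (Real.abs_sin_le_one _)).trans ?_
    rw [abs_div, abs_neg, abs_mul, abs_mul, abs_pow, abs_pow, abs_two, ← sq_abs t]
    have h : |τ| ≤ |t| := by rw [abs_of_neg hτ, abs_of_neg ht0]; linarith
    have h0 : 0 < |t| := abs_pos.mpr ht0.ne
    rw [div_le_div_iff₀ (by positivity) (by positivity)]
    have : 2 * |κ| * |τ| ^ 2 * |t| ^ 2 = (2 * |κ| * |τ| * |t| ^ 2) * |τ| := by ring
    rw [this]
    have : 2 * |κ| * |τ| * |t| ^ 3 = (2 * |κ| * |τ| * |t| ^ 2) * |t| := by ring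
    rw [this]
    exact mul_le_mul_of_nonneg_left h (by positivity)
  have h2 : |κ * τ ^ 2 / t ^ 2 * (Real.cos (κ * (τ - t)) * (-κ))| ≤ κ ^ 2 * τ ^ 2 / t ^ 2 := by
    have : κ * τ ^ 2 / t ^ 2 * (Real.cos (κ * (τ - t)) * (-κ))
      = -(κ ^ 2 * τ ^ 2 / t ^ 2) * Real.cos (κ * (τ - t)) := by ring
    rw [this, abs_mul, abs_neg, abs_of_nonneg (by positivity : 0 ≤ κ ^ 2 * τ ^ 2 / t ^ 2)]
    exact mul_le_of_le_one_right (by positivity) (Real.abs_cos_le_one _)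
  rw [add_div]
  exact (abs_add_le _ _).trans (add_le_add h1 h2)

lemma gA_hasDerivAt (τ κ t : ℝ) (ht : t ≠ 0) : HasDerivAt (gA τ κ) (gA' τ κ t) t := by
  have h1 : HasDerivAt (fun t : ℝ => κ * τ ^ 2 / t ^ 2) (-(2 * κ * τ ^ 2) / t ^ 3) t := by
    have := ((hasDerivAt_pow 2 t).inv (pow_ne_zero 2 ht)).const_mul (κ * τ ^ 2)
    refine (this.congr_deriv ?_)
    field_simp
    norm_num
    ring
  have h2 : HasDerivAt (fun t : ℝ => Real.sin (κ * (τ - t))) (Real.cos (κ * (τ - t)) * (-κ)) t := by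
    have h3 : HasDerivAt (fun t : ℝ => κ * (τ - t)) (-κ) t := by
      simpa using ((hasDerivAt_id t).const_sub τ).const_mul κ
    exact h3.sin
  exact h1.mul h2

lemma contOn_exp (q : ℝ) (s : Set ℝ) :
    ContinuousOn (fun t : ℝ => Complex.exp (-(Complex.I * (q : ℂ) * (t : ℂ)))) s := by
  fun_prop

lemma contOn_gA (τ κ : ℝ) (hτ : τ < 0) : ContinuousOn (gA τ κ) (Set.Iic τ) := fun t ht =>
  (gA_hasDerivAt τ κ t (lt_of_le_of_lt ht hτ).ne).continuousAt.continuousWithinAt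

lemma contOn_gA' (τ κ : ℝ) (hτ : τ < 0) : ContinuousOn (gA' τ κ) (Set.Iic τ) := by
  unfold gA'
  have h : ∀ t ∈ Set.Iic τ, t ≠ 0 := fun t ht => (lt_of_le_of_lt ht hτ).ne
  refine ContinuousOn.add (ContinuousOn.mul (ContinuousOn.div (by fun_prop) (by fun_prop) ?_)
    (by fun_prop)) (ContinuousOn.mul (ContinuousOn.div (by fun_prop) (by fun_prop) ?_)
    (by fun_prop))
  · exact fun t ht => pow_ne_zero 3 (h t ht)
  · exact fun t ht => pow_ne_zero 2 (h t ht)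

lemma intOn_gA (τ κ q : ℝ) (hτ : τ < 0) : IntegrableOn (fun t : ℝ => (gA τ κ t : ℂ) *
    Complex.exp (-(Complex.I * (q : ℂ) * (t : ℂ)))) (Set.Iic τ) := by
  refine integrableOn_Iic_of_bound τ hτ _ ?_ (|κ| * τ ^ 2) ?_
  · exact (Complex.continuous_ofReal.comp_continuousOn (contOn_gA τ κ hτ)).mul (contOn_exp q _)
  · intro t ht
    rw [norm_mul, norm_cexp_aux, mul_one, Complex.norm_real, Real.norm_eq_abs]
    exact gA_bound τ κ t

lemma intOn_gA' (τ κ q : ℝ) (hτ : τ < 0) : IntegrableOn (fun t : ℝ => (gA' τ κ t : ℂ) *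
    Complex.exp (-(Complex.I * (q : ℂ) * (t : ℂ)))) (Set.Iic τ) := by
  refine integrableOn_Iic_of_bound τ hτ _ ?_ (2 * |κ| * |τ| + κ ^ 2 * τ ^ 2) ?_
  · exact (Complex.continuous_ofReal.comp_continuousOn (contOn_gA' τ κ hτ)).mul (contOn_exp q _)
  · intro t ht
    rw [norm_mul, norm_cexp_aux, mul_one, Complex.norm_real, Real.norm_eq_abs]
    exact gA'_bound τ κ t hτ ht

lemma auxA_eq (τ κ q : ℝ) : auxA τ κ q = ∫ t in Set.Iic τ, (gA τ κ t : ℂ) *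
    Complex.exp (-(Complex.I * (q : ℂ) * (t : ℂ))) := rfl

lemma auxA_continuous (τ κ : ℝ) (hτ : τ < 0) : Continuous (auxA τ κ) := by
  have : auxA τ κ = fun q : ℝ => ∫ t in Set.Iic τ, (gA τ κ t : ℂ) *
    Complex.exp (-(Complex.I * (q : ℂ) * (t : ℂ))) := by ext q; exact auxA_eq τ κ q
  rw [this]
  refine continuous_of_dominated (bound := fun t => |gA τ κ t|)
    (fun q => (intOn_gA τ κ q hτ).aestronglyMeasurable) ?_ ?_ ?_
  · intro q
    refine Eventually.of_forall fun t => ?_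
    rw [norm_mul, norm_cexp_aux, mul_one, Complex.norm_real, Real.norm_eq_abs]
  · have := (intOn_gA τ κ 0 hτ).norm
    refine this.congr (Eventually.of_forall fun t => ?_)
    simp
  · refine Eventually.of_forall fun t => ?_
    fun_prop

lemma auxA_ibp (τ κ q : ℝ) (hτ : τ < 0) :
    (Complex.I * q) * auxA τ κ q = ∫ t in Set.Iic τ, (gA' τ κ t : ℂ) *
      Complex.exp (-(Complex.I * (q : ℂ) * (t : ℂ))) := by
  have h := integral_Iic_of_hasDerivAt_of_tendsto' (a := τ) (m := (0 : ℂ))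
    (f := fun t : ℝ => (gA τ κ t : ℂ) * Complex.exp (-(Complex.I * (q : ℂ) * (t : ℂ))))
    (f' := fun t : ℝ => (gA' τ κ t : ℂ) * Complex.exp (-(Complex.I * (q : ℂ) * (t : ℂ))) -
      (Complex.I * q) * ((gA τ κ t : ℂ) * Complex.exp (-(Complex.I * (q : ℂ) * (t : ℂ)))))
    ?_ ?_ ?_
  · rw [integral_sub (intOn_gA' τ κ q hτ) ((intOn_gA τ κ q hτ).const_mul _),
      integral_const_mul, ← auxA_eq] at h
    have h0 : gA τ κ τ = 0 := by simp [gA]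
    rw [h0] at h
    simp only [Complex.ofReal_zero, zero_mul, sub_zero] at h
    exact (sub_eq_zero.mp h).symm
  · intro t ht
    have h1 := (gA_hasDerivAt τ κ t (lt_of_le_of_lt ht hτ).ne).ofReal_comp
    have h2 : HasDerivAt (fun t : ℝ => -(Complex.I * (q : ℂ) * (t : ℂ))) (-(Complex.I * q)) t := by
      have h3 : HasDerivAt (fun t : ℝ => (t : ℂ)) 1 t := Complex.ofRealCLM.hasDerivAt (x := t)
      refine ((h3.const_mul (Complex.I * (q : ℂ))).neg).congr_deriv ?_
      rw [mul_one]
    refine (h1.mul h2.cexp).congr_deriv ?_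
    ring
  · exact (intOn_gA' τ κ q hτ).sub ((intOn_gA τ κ q hτ).const_mul _)
  · rw [tendsto_zero_iff_norm_tendsto_zero]
    refine squeeze_zero (g := fun t : ℝ => |κ| * τ ^ 2 / t ^ 2) (fun _ => norm_nonneg _) ?_ ?_
    · intro t
      rw [norm_mul, norm_cexp_aux, mul_one, Complex.norm_real, Real.norm_eq_abs]
      exact gA_bound τ κ t
    · refine Tendsto.div_atTop tendsto_const_nhds ?_
      have : Tendsto (fun t : ℝ => |t| ^ 2) atBot atTop :=
        (tendsto_pow_atTop two_ne_zero).comp tendsto_abs_atBot_atTop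
      simpa using this

lemma auxA_decay (τ κ : ℝ) (hτ : τ < 0) : ∃ C, 0 ≤ C ∧ ∀ q : ℝ, ‖auxA τ κ q‖ ≤ C / (1 + |q|) := by
  refine ⟨(∫ t in Set.Iic τ, |gA τ κ t|) + ∫ t in Set.Iic τ, |gA' τ κ t|, ?_, fun q => ?_⟩
  · exact add_nonneg (integral_nonneg fun _ => abs_nonneg _) (integral_nonneg fun _ => abs_nonneg _)
  · have h1 : ‖auxA τ κ q‖ ≤ ∫ t in Set.Iic τ, |gA τ κ t| := by
      rw [auxA_eq]
      refine (norm_integral_le_integral_norm _).trans (le_of_eq ?_)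
      simp only [norm_mul, norm_cexp_aux, mul_one, Complex.norm_real, Real.norm_eq_abs]
    have h2 : |q| * ‖auxA τ κ q‖ ≤ ∫ t in Set.Iic τ, |gA' τ κ t| := by
      have : |q| * ‖auxA τ κ q‖ = ‖(Complex.I * q) * auxA τ κ q‖ := by simp
      rw [this, auxA_ibp τ κ q hτ]
      refine (norm_integral_le_integral_norm _).trans (le_of_eq ?_)
      simp only [norm_mul, norm_cexp_aux, mul_one, Complex.norm_real, Real.norm_eq_abs]
    rw [le_div_iff₀ (by positivity)]
    linarith

/-- Radial dominating function. -/
noncomputable def hR (w : ℝ) : ℝ := 1 / (w ^ 2 * (1 + w) ^ 2)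

lemma hR_integrable : Integrable (fun p : EuclideanSpace ℝ (Fin 3) => hR ‖p‖) := by
  rw [integrable_fun_norm_addHaar]
  have hd : Module.finrank ℝ (EuclideanSpace ℝ (Fin 3)) - 1 = 2 := by simp
  rw [hd]
  have hi : IntegrableOn (fun t : ℝ => (1 + t ^ 2)⁻¹) (Set.Ioi 0) :=
    integrable_inv_one_add_sq.integrableOn
  refine Integrable.mono' hi ?_ ?_
  · refine Measurable.aestronglyMeasurable ?_
    unfold hR
    simp only [smul_eq_mul]
    fun_prop
  · refine (ae_restrict_iff' measurableSet_Ioi).mpr (Eventually.of_forall fun t ht => ?_)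
    have ht' : 0 < t := ht
    unfold hR
    have e : t ^ 2 • (1 / (t ^ 2 * (1 + t) ^ 2)) = ((1 + t) ^ 2)⁻¹ := by
      rw [smul_eq_mul]; field_simp
    rw [e, Real.norm_eq_abs, abs_of_nonneg (by positivity)]
    exact inv_anti₀ (by positivity) (by nlinarith)

lemma hR_compare (D x w : ℝ) (hx : 0 < x) (hw : 0 < w) (h : 1 + w ≤ D * (1 + x)) :
    1 / w ^ 2 * (1 / (1 + x) ^ 2) ≤ D ^ 2 * hR w := by
  unfold hR
  rw [← one_div_mul_one_div]
  have : 1 / (1 + x) ^ 2 ≤ D ^ 2 * (1 / (1 + w) ^ 2) := by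
    rw [mul_one_div, div_le_div_iff₀ (by positivity) (by positivity), one_mul, ← mul_pow]
    exact pow_le_pow_left₀ (by positivity) h 2
  calc 1 / w ^ 2 * (1 / (1 + x) ^ 2) ≤ 1 / w ^ 2 * (D ^ 2 * (1 / (1 + w) ^ 2)) :=
        mul_le_mul_of_nonneg_left this (by positivity)
    _ = _ := by ring

lemma three_bound (α x y z : ℝ) (hα : 0 < α) (hx : 0 < x) (hy : 0 < y) (hz : 0 < z)
    (h : α ≤ x + y) :
    1 / (y * z * x) ≤ α⁻¹ * (1 / x ^ 2 + 1 / y ^ 2 + 1 / z ^ 2) := by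
  have e : 1 / (y * z * x) = (x + y)⁻¹ * (x⁻¹ * z⁻¹ + y⁻¹ * z⁻¹) := by
    field_simp; ring
  rw [e]
  have h1 : (x + y)⁻¹ ≤ α⁻¹ := inv_anti₀ hα h
  have h2 : x⁻¹ * z⁻¹ + y⁻¹ * z⁻¹ ≤ 1 / x ^ 2 + 1 / y ^ 2 + 1 / z ^ 2 := by
    simp only [one_div, ← inv_pow]
    nlinarith [sq_nonneg (x⁻¹ - z⁻¹), sq_nonneg (y⁻¹ - z⁻¹), sq_nonneg x⁻¹, sq_nonneg y⁻¹]
  exact mul_le_mul h1 h2 (by positivity) (by positivity)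

lemma key_integrable (a c : EuclideanSpace ℝ (Fin 3)) (ha : a ≠ 0) :
    Integrable (fun p : EuclideanSpace ℝ (Fin 3) =>
      1 / (‖p - a‖ * ‖c + p‖ * ‖p‖) * (1 / (1 + ‖p‖) ^ 2)) := by
  have i1 := hR_integrable
  have i2 : Integrable (fun p : EuclideanSpace ℝ (Fin 3) => hR ‖p - a‖) := i1.comp_sub_right a
  have i3 : Integrable (fun p : EuclideanSpace ℝ (Fin 3) => hR ‖c + p‖) := i1.comp_add_left c
  have hi := (((i1.add i2).add i3).const_mul (‖a‖⁻¹ * (1 + ‖a‖ + ‖c‖) ^ 2))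
  refine Integrable.mono' hi ?_ ?_
  · exact (Measurable.aestronglyMeasurable (by fun_prop))
  · refine Eventually.of_forall fun p => ?_
    rw [Real.norm_eq_abs, abs_of_nonneg (by positivity)]
    simp only [Pi.add_apply]
    have hn : ∀ w, 0 ≤ hR w := fun w => by unfold hR; positivity
    have hR0 : 0 ≤ ‖a‖⁻¹ * (1 + ‖a‖ + ‖c‖) ^ 2 * (hR ‖p‖ + hR ‖p - a‖ + hR ‖c + p‖) := by
      have := hn ‖p‖
      have := hn ‖p - a‖
      have := hn ‖c + p‖
      positivity
    rcases (norm_nonneg p).eq_or_lt with h | hx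
    · rw [← h] at hR0 ⊢; simpa using hR0
    rcases (norm_nonneg (p - a)).eq_or_lt with h | hy
    · rw [← h] at hR0 ⊢; simpa using hR0
    rcases (norm_nonneg (c + p)).eq_or_lt with h | hz
    · rw [← h] at hR0 ⊢; simpa using hR0
    have hα : 0 < ‖a‖ := norm_pos_iff.mpr ha
    have t1 : ‖a‖ ≤ ‖p‖ + ‖p - a‖ := by
      have := norm_sub_le p (p - a)
      simpa using this
    have t2 : ‖p - a‖ ≤ ‖p‖ + ‖a‖ := norm_sub_le _ _
    have t3 : ‖c + p‖ ≤ ‖c‖ + ‖p‖ := norm_add_le _ _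
    have hc := norm_nonneg c
    have b := three_bound ‖a‖ ‖p‖ ‖p - a‖ ‖c + p‖ hα hx hy hz t1
    have c1 := hR_compare (1 + ‖a‖ + ‖c‖) ‖p‖ ‖p‖ hx hx (by nlinarith)
    have c2 := hR_compare (1 + ‖a‖ + ‖c‖) ‖p‖ ‖p - a‖ hx hy (by nlinarith)
    have c3 := hR_compare (1 + ‖a‖ + ‖c‖) ‖p‖ ‖c + p‖ hx hz (by nlinarith)
    calc _ ≤ ‖a‖⁻¹ * (1 / ‖p‖ ^ 2 + 1 / ‖p - a‖ ^ 2 + 1 / ‖c + p‖ ^ 2) * (1 / (1 + ‖p‖) ^ 2) :=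
          mul_le_mul_of_nonneg_right b (by positivity)
      _ = ‖a‖⁻¹ * (1 / ‖p‖ ^ 2 * (1 / (1 + ‖p‖) ^ 2) + 1 / ‖p - a‖ ^ 2 * (1 / (1 + ‖p‖) ^ 2)
            + 1 / ‖c + p‖ ^ 2 * (1 / (1 + ‖p‖) ^ 2)) := by ring
      _ ≤ ‖a‖⁻¹ * ((1 + ‖a‖ + ‖c‖) ^ 2 * hR ‖p‖ + (1 + ‖a‖ + ‖c‖) ^ 2 * hR ‖p - a‖
            + (1 + ‖a‖ + ‖c‖) ^ 2 * hR ‖c + p‖) := by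
          refine mul_le_mul_of_nonneg_left ?_ (by positivity)
          linarith
      _ = _ := by ring

/-- One summand of the integrand. -/
noncomputable def termB (τ ε : ℝ) (a b c p : EuclideanSpace ℝ (Fin 3)) : ℂ :=
  (((Real.exp (-(ε * (‖p - a‖ + ‖c + p‖ + ‖p‖))) /
            (‖p - a‖ * ‖c + p‖ * ‖p‖) : ℝ)) : ℂ) *
          auxA τ (‖a‖ / Real.sqrt 3) (‖p - a‖ + ‖p‖) *
          auxA τ (‖c‖ / Real.sqrt 3) (-(‖c + p‖ + ‖p‖)) *
          auxA τ (‖b‖ / Real.sqrt 3) (‖c + p‖ - ‖p - a‖)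

lemma B0eps_eq (m τ : ℝ) (k1 k2 k3 : EuclideanSpace ℝ (Fin 3)) (ε : ℝ) :
    B0eps m τ k1 k2 k3 ε =
  ((m ^ 6 / (32 * Real.sqrt 3 * (‖k1‖ ^ 2 * ‖k2‖ ^ 2 * ‖k3‖ ^ 2)) : ℝ) : ℂ) *
    ∫ p : EuclideanSpace ℝ (Fin 3), ∑ σ : Equiv.Perm (Fin 3),
      termB τ ε (![k1, k2, k3] (σ 0)) (![k1, k2, k3] (σ 1)) (![k1, k2, k3] (σ 2)) p := rfl

lemma termB_measurable (τ ε : ℝ) (hτ : τ < 0) (a b c : EuclideanSpace ℝ (Fin 3)) :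
    Measurable (termB τ ε a b c) := by
  unfold termB
  have m1 := (auxA_continuous τ (‖a‖ / Real.sqrt 3) hτ).measurable
  have m2 := (auxA_continuous τ (‖b‖ / Real.sqrt 3) hτ).measurable
  have m3 := (auxA_continuous τ (‖c‖ / Real.sqrt 3) hτ).measurable
  have n1 : Measurable fun p : EuclideanSpace ℝ (Fin 3) => ‖p - a‖ + ‖p‖ := by fun_prop
  have n2 : Measurable fun p : EuclideanSpace ℝ (Fin 3) => ‖c + p‖ - ‖p - a‖ := by fun_prop
  have n3 : Measurable fun p : EuclideanSpace ℝ (Fin 3) => -(‖c + p‖ + ‖p‖) := by fun_prop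
  have n0 : Measurable fun p : EuclideanSpace ℝ (Fin 3) =>
    (((Real.exp (-(ε * (‖p - a‖ + ‖c + p‖ + ‖p‖))) / (‖p - a‖ * ‖c + p‖ * ‖p‖) : ℝ)) : ℂ) :=
    Complex.measurable_ofReal.comp (by fun_prop)
  exact ((n0.mul (m1.comp n1)).mul (m3.comp n3)).mul (m2.comp n2)

lemma termB_bound (τ : ℝ) (hτ : τ < 0) (a b c : EuclideanSpace ℝ (Fin 3)) :
    ∃ C : ℝ, ∀ ε : ℝ, 0 ≤ ε → ∀ p, ‖termB τ ε a b c p‖ ≤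
      C * (1 / (‖p - a‖ * ‖c + p‖ * ‖p‖) * (1 / (1 + ‖p‖) ^ 2)) := by
  obtain ⟨C1, h1, H1⟩ := auxA_decay τ (‖a‖ / Real.sqrt 3) hτ
  obtain ⟨C2, h2, H2⟩ := auxA_decay τ (‖b‖ / Real.sqrt 3) hτ
  obtain ⟨C3, h3, H3⟩ := auxA_decay τ (‖c‖ / Real.sqrt 3) hτ
  refine ⟨C1 * C3 * C2, fun ε hε p => ?_⟩
  have hp := norm_nonneg p
  have ha := norm_nonneg (p - a)
  have hc := norm_nonneg (c + p)
  have A1 : ‖auxA τ (‖a‖ / Real.sqrt 3) (‖p - a‖ + ‖p‖)‖ ≤ C1 / (1 + ‖p‖) := by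
    refine (H1 _).trans (div_le_div_of_nonneg_left h1 (by positivity) ?_)
    rw [abs_of_nonneg (by positivity)]; linarith
  have A3 : ‖auxA τ (‖c‖ / Real.sqrt 3) (-(‖c + p‖ + ‖p‖))‖ ≤ C3 / (1 + ‖p‖) := by
    refine (H3 _).trans (div_le_div_of_nonneg_left h3 (by positivity) ?_)
    rw [abs_neg, abs_of_nonneg (by positivity)]; linarith
  have A2 : ‖auxA τ (‖b‖ / Real.sqrt 3) (‖c + p‖ - ‖p - a‖)‖ ≤ C2 := by
    refine (H2 _).trans (div_le_self h2 ?_)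
    linarith [abs_nonneg (‖c + p‖ - ‖p - a‖)]
  have A0 : ‖(((Real.exp (-(ε * (‖p - a‖ + ‖c + p‖ + ‖p‖))) /
            (‖p - a‖ * ‖c + p‖ * ‖p‖) : ℝ)) : ℂ)‖ ≤ 1 / (‖p - a‖ * ‖c + p‖ * ‖p‖) := by
    rw [Complex.norm_real, Real.norm_eq_abs, abs_of_nonneg (by positivity)]
    refine div_le_div_of_nonneg_right ?_ (by positivity)
    rw [Real.exp_le_one_iff]
    have : 0 ≤ ε * (‖p - a‖ + ‖c + p‖ + ‖p‖) := by positivity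
    linarith
  unfold termB
  rw [norm_mul, norm_mul, norm_mul]
  calc _ ≤ 1 / (‖p - a‖ * ‖c + p‖ * ‖p‖) * (C1 / (1 + ‖p‖)) * (C3 / (1 + ‖p‖)) * C2 := by
        gcongr
    _ = _ := by
        have : (1 + ‖p‖) ≠ 0 := by positivity
        field_simp

lemma B0eps_tendsto (m τ : ℝ) (hτ : τ < 0) (k1 k2 k3 : EuclideanSpace ℝ (Fin 3))
    (hk1 : k1 ≠ 0) (hk2 : k2 ≠ 0) (hk3 : k3 ≠ 0) :
    Tendsto (fun ε => B0eps m τ k1 k2 k3 ε) (nhdsWithin (0 : ℝ) (Set.Ioi 0))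
      (nhds (B0eps m τ k1 k2 k3 0)) := by
  simp only [B0eps_eq]
  refine Tendsto.const_mul _ ?_
  have hk : ∀ i : Fin 3, ![k1, k2, k3] i ≠ 0 := by
    intro i; fin_cases i <;> simpa
  generalize ![k1, k2, k3] = k at hk
  choose C hC using fun σ : Equiv.Perm (Fin 3) => termB_bound τ hτ (k (σ 0)) (k (σ 1)) (k (σ 2))
  refine tendsto_integral_filter_of_dominated_convergence
    (fun p => ∑ σ : Equiv.Perm (Fin 3), C σ * (1 / (‖p - k (σ 0)‖ * ‖k (σ 2) + p‖ * ‖p‖) *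
      (1 / (1 + ‖p‖) ^ 2))) ?_ ?_ ?_ ?_
  · refine Eventually.of_forall fun ε => ?_
    refine (Finset.measurable_fun_sum _ fun σ _ => ?_).aestronglyMeasurable
    exact termB_measurable τ ε hτ _ _ _
  · refine eventually_nhdsWithin_of_forall fun ε hε => Eventually.of_forall fun p => ?_
    refine (norm_sum_le _ _).trans (Finset.sum_le_sum fun σ _ => ?_)
    exact hC σ ε (le_of_lt hε) p
  · exact integrable_finsetSum _ fun σ _ => (key_integrable _ _ (hk _)).const_mul _
  · refine Eventually.of_forall fun p => ?_
    refine Tendsto.mono_left ?_ nhdsWithin_le_nhds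
    refine Continuous.tendsto (f := fun ε : ℝ => ∑ σ : Equiv.Perm (Fin 3),
      termB τ ε (k (σ 0)) (k (σ 1)) (k (σ 2)) p) ?_ 0
    unfold termB
    refine continuous_finsetSum _ fun σ _ => ?_
    refine ((Continuous.mul ?_ continuous_const).mul continuous_const).mul continuous_const
    refine Complex.continuous_ofReal.comp ?_
    simp only [div_eq_mul_inv]
    fun_prop

lemma termB_scale (τ ε l : ℝ) (hl : 0 < l) (a b c p : EuclideanSpace ℝ (Fin 3)) :
    termB (l * τ) ε (l⁻¹ • a) (l⁻¹ • b) (l⁻¹ • c) (l⁻¹ • p) =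
      ((l ^ 3 : ℝ) : ℂ) * termB τ (l⁻¹ * ε) a b c p := by
  have hn : ∀ v : EuclideanSpace ℝ (Fin 3), ‖l⁻¹ • v‖ = l⁻¹ * ‖v‖ := fun v => by
    rw [norm_smul, Real.norm_eq_abs, abs_of_pos (inv_pos.mpr hl)]
  unfold termB
  rw [← smul_sub, ← smul_add]
  simp only [hn]
  have e1 : -(l⁻¹ * ‖c + p‖ + l⁻¹ * ‖p‖) = l⁻¹ * (-(‖c + p‖ + ‖p‖)) := by ring
  have e2 : l⁻¹ * ‖p - a‖ + l⁻¹ * ‖p‖ = l⁻¹ * (‖p - a‖ + ‖p‖) := by ring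
  have e0 : Real.exp (-(ε * (l⁻¹ * ‖p - a‖ + l⁻¹ * ‖c + p‖ + l⁻¹ * ‖p‖))) /
      (l⁻¹ * ‖p - a‖ * (l⁻¹ * ‖c + p‖) * (l⁻¹ * ‖p‖)) =
      l ^ 3 * (Real.exp (-(l⁻¹ * ε * (‖p - a‖ + ‖c + p‖ + ‖p‖))) /
        (‖p - a‖ * ‖c + p‖ * ‖p‖)) := by
    have f1 : l⁻¹ * ‖p - a‖ * (l⁻¹ * ‖c + p‖) * (l⁻¹ * ‖p‖)
        = (l ^ 3)⁻¹ * (‖p - a‖ * ‖c + p‖ * ‖p‖) := by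
      rw [← inv_pow]; ring
    have f2 : -(ε * (l⁻¹ * ‖p - a‖ + l⁻¹ * ‖c + p‖ + l⁻¹ * ‖p‖))
        = -(l⁻¹ * ε * (‖p - a‖ + ‖c + p‖ + ‖p‖)) := by ring
    rw [f1, f2, div_eq_mul_inv, mul_inv, inv_inv]
    ring
  rw [e0, e1, e2, ← mul_sub, mul_div_assoc, mul_div_assoc, mul_div_assoc,
    auxA_scale _ _ _ _ hl, auxA_scale _ _ _ _ hl, auxA_scale _ _ _ _ hl, Complex.ofReal_mul]
  ring

lemma B0eps_scale (m τ : ℝ) (k1 k2 k3 : EuclideanSpace ℝ (Fin 3)) (l ε : ℝ) (hl : 0 < l) :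
    B0eps m (l * τ) (l⁻¹ • k1) (l⁻¹ • k2) (l⁻¹ • k3) ε =
      ((l ^ 6 : ℝ) : ℂ) * B0eps m τ k1 k2 k3 (l⁻¹ * ε) := by
  have hn : ∀ v : EuclideanSpace ℝ (Fin 3), ‖l⁻¹ • v‖ = l⁻¹ * ‖v‖ := fun v => by
    rw [norm_smul, Real.norm_eq_abs, abs_of_pos (inv_pos.mpr hl)]
  have hk : ![l⁻¹ • k1, l⁻¹ • k2, l⁻¹ • k3] = fun i => l⁻¹ • ![k1, k2, k3] i := by
    ext i : 1; fin_cases i <;> rfl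
  rw [B0eps_eq, B0eps_eq, hk]
  generalize ![k1, k2, k3] = k
  have h := Measure.integral_comp_inv_smul_of_nonneg volume
    (fun p : EuclideanSpace ℝ (Fin 3) => ∑ σ : Equiv.Perm (Fin 3),
      termB (l * τ) ε (l⁻¹ • k (σ 0)) (l⁻¹ • k (σ 1)) (l⁻¹ • k (σ 2)) p) hl.le
  simp only [termB_scale _ _ _ hl, ← Finset.mul_sum] at h
  rw [integral_const_mul, finrank_euclideanSpace_fin, Complex.real_smul] at h
  have hl3 : ((l ^ 3 : ℝ) : ℂ) ≠ 0 := by exact_mod_cast (pow_pos hl 3).ne'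
  rw [← mul_left_cancel₀ hl3 h, ← mul_assoc ((l ^ 6 : ℝ) : ℂ), ← Complex.ofReal_mul]
  congr 2
  simp only [hn]
  have : 32 * √3 * ((l⁻¹ * ‖k1‖) ^ 2 * (l⁻¹ * ‖k2‖) ^ 2 * (l⁻¹ * ‖k3‖) ^ 2)
      = (l ^ 6)⁻¹ * (32 * √3 * (‖k1‖ ^ 2 * ‖k2‖ ^ 2 * ‖k3‖ ^ 2)) := by
    rw [← inv_pow]; ring
  rw [this, div_eq_mul_inv, mul_inv, inv_inv]
  ring

/-- Scaling behaviour of the bispectrum: for every `λ > 0`,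
`B₀(λτ, k⃗₁/λ, k⃗₂/λ, k⃗₃/λ) = λ⁶ B₀(τ, k⃗₁, k⃗₂, k⃗₃)`; equivalently, `k₁²k₂²k₃² B₀` is
invariant under the simultaneous rescaling `(τ, k⃗₁, k⃗₂, k⃗₃) ↦ (λτ, k⃗₁/λ, k⃗₂/λ, k⃗₃/λ)`. -/
theorem B0_scaling (m τ : ℝ) (hm : 0 < m) (hτ : τ < 0)
    (k1 k2 k3 : EuclideanSpace ℝ (Fin 3)) (hk1 : k1 ≠ 0) (hk2 : k2 ≠ 0) (hk3 : k3 ≠ 0)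
    (l : ℝ) (hl : 0 < l) :
    B0 m (l * τ) (l⁻¹ • k1) (l⁻¹ • k2) (l⁻¹ • k3) = ((l ^ 6 : ℝ) : ℂ) * B0 m τ k1 k2 k3 := by

  have h1 := B0eps_tendsto m τ hτ k1 k2 k3 hk1 hk2 hk3
  have hs : Tendsto (fun ε : ℝ => l⁻¹ * ε) (nhdsWithin (0 : ℝ) (Set.Ioi 0))
      (nhdsWithin (0 : ℝ) (Set.Ioi 0)) := by
    refine tendsto_nhdsWithin_iff.mpr ⟨?_, ?_⟩
    · have : Tendsto (fun ε : ℝ => l⁻¹ * ε) (nhds 0) (nhds (l⁻¹ * 0)) :=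
        (continuous_const.mul continuous_id).tendsto 0
      rw [mul_zero] at this
      exact this.mono_left nhdsWithin_le_nhds
    · exact eventually_nhdsWithin_of_forall fun ε hε => mul_pos (inv_pos.mpr hl) hε
  have h2 := (h1.comp hs).const_mul ((l ^ 6 : ℝ) : ℂ)
  unfold B0
  rw [h1.limUnder_eq]
  refine Tendsto.limUnder_eq ?_
  refine h2.congr fun ε => ?_
  exact (B0eps_scale m τ k1 k2 k3 l ε hl).symm
end
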